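/- arXiv:math-ph/0312030 — 6 statements merged into one kernel-verified Lean document; each statement's English description precedes it below -/
import Mathlib

section
/- Let g be a Z-graded Lie algebra with a grading element H (so g_j is the j-eigenspace of ad H), and let e ∈ g_2 with [e,g_0] = g_2. Then the set of good elements in g_2 (elements satisfying conditions (0.1) and (0.2)) is stable under the adjoint action of the group G_0 of grading-preserving automorphisms, and any good element has Zariski dense G_0-orbit in g_2. -/
/-- `e` is a good element for the ℤ-grading `g`: `e ∈ g 2`, `ad e : g j → g (j+2)` is
injective for `j ≤ -1` and surjective for `j ≥ -1`. -/
def IsGoodElement {F L : Type*} [Field F] [LieRing L] [LieAlgebra F L]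
    (g : ℤ → Submodule F L) (e : L) : Prop :=
  e ∈ g 2 ∧
  (∀ j : ℤ, j ≤ -1 → ∀ x ∈ g j, ⁅e, x⁆ = 0 → x = 0) ∧
  (∀ j : ℤ, -1 ≤ j → ∀ y ∈ g (j + 2), ∃ x ∈ g j, ⁅e, x⁆ = y)

namespace MvPolynomial

/-- A polynomial vanishing on the rational points of an affine scheme over an algebraically
closed field vanishes on its points with values in any reduced algebra. -/
theorem aeval_eq_zero_of_forall_zeroLocus {F σ K : Type*} [Field F] [IsAlgClosed F] [Finite σ]
    [CommRing K] [Algebra F K] [IsReduced K] (S : Set (MvPolynomial σ F)) (f : MvPolynomial σ F)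
    (h : ∀ x : σ → F, (∀ s ∈ S, aeval x s = 0) → aeval x f = 0)
    (a : σ → K) (ha : ∀ s ∈ S, aeval a s = 0) : aeval a f = 0 := by
  have h1 : f ∈ (Ideal.span S).radical := by
    rw [← vanishingIdeal_zeroLocus_eq_radical (K := F), zeroLocus_span]
    exact h
  obtain ⟨n, hn⟩ := h1
  have h2 : Ideal.span S ≤ RingHom.ker (aeval (R := F) a) := Ideal.span_le.2 ha
  have h3 := h2 hn
  rw [RingHom.mem_ker, map_pow] at h3
  exact eq_zero_of_pow_eq_zero h3

/-- The derivative of a polynomial in the constant direction `v`. -/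
noncomputable def dirDeriv {F ι : Type*} [Field F] (v : ι → F) :
    Derivation F (MvPolynomial ι F) (MvPolynomial ι F) :=
  mkDerivation F fun i => C (v i)

theorem coeff_one_aeval {F ι : Type*} [Field F] (y : ι → PowerSeries F) (p : MvPolynomial ι F) :
    PowerSeries.coeff 1 (aeval y p) =
      eval (fun i => PowerSeries.constantCoeff (y i))
        (dirDeriv (fun i => PowerSeries.coeff 1 (y i)) p) := by
  have hc : ∀ p : MvPolynomial ι F, PowerSeries.constantCoeff (aeval y p) =
      eval (fun i => PowerSeries.constantCoeff (y i)) p := by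
    intro p
    induction p using MvPolynomial.induction_on with
    | C a => simp
    | add p q hp hq => simp [hp, hq]
    | mul_X p i hp => simp [hp]
  induction p using MvPolynomial.induction_on with
  | C a => simp [dirDeriv]
  | add p q hp hq => simp [hp, hq]
  | mul_X p i hp =>
    rw [map_mul, aeval_X, PowerSeries.coeff_one_mul, Derivation.leibniz, hp, hc]
    simp [dirDeriv, mkDerivation_X]
    ring

/-- Taylor's formula: a polynomial all of whose iterated derivatives in the direction `v` vanish
at `x` vanishes at `x + v`. -/
theorem eval_add_eq_zero_of_iterate_dirDeriv {F ι : Type*} [Field F] [CharZero F]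
    (x v : ι → F) (p : MvPolynomial ι F) (h : ∀ n : ℕ, eval x ((dirDeriv v)^[n] p) = 0) :
    eval (x + v) p = 0 := by
  let φ : MvPolynomial ι F →ₐ[F] Polynomial F :=
    aeval fun i => Polynomial.C (x i) + Polynomial.C (v i) * Polynomial.X
  have hφ : ∀ (t : F) (q : MvPolynomial ι F), (φ q).eval t = eval (x + t • v) q := by
    intro t q
    induction q using MvPolynomial.induction_on with
    | C a => simp [φ]
    | add p q hp hq => simp [hp, hq]
    | mul_X p i hp => simp [hp, φ]; left; ring
  have hd : ∀ q : MvPolynomial ι F, Polynomial.derivative (φ q) = φ (dirDeriv v q) := by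
    intro q
    induction q using MvPolynomial.induction_on with
    | C a => simp [φ, dirDeriv]
    | add p q hp hq => simp [hp, hq]
    | mul_X p i hp =>
      rw [map_mul, Polynomial.derivative_mul, hp, Derivation.leibniz]
      simp [φ, dirDeriv, mkDerivation_X]
      ring
  have hdn : ∀ n : ℕ, Polynomial.derivative^[n] (φ p) = φ ((dirDeriv v)^[n] p) := by
    intro n
    induction n with
    | zero => rfl
    | succ n ih => rw [Function.iterate_succ_apply', Function.iterate_succ_apply', ih, hd]
  have h0 : φ p = 0 := by
    ext n
    have h1 := Polynomial.coeff_iterate_derivative (k := n) (φ p) 0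
    rw [hdn, Polynomial.coeff_zero_eq_eval_zero, hφ, zero_smul, add_zero, h] at h1
    simpa [Nat.descFactorial_self, Nat.factorial_ne_zero] using h1.symm
  have := hφ 1 p
  rw [h0] at this
  simpa using this.symm

end MvPolynomial

section Graded

variable {F L : Type*} [Field F] [LieRing L] [LieAlgebra F L]

/-- The pieces of a grading with grading element `H` are the eigenspaces of `ad H`. -/
theorem mem_of_lie_eq_smul [CharZero F] {g : ℤ → Submodule F L}
    (hdecomp : DirectSum.IsInternal g) {H : L}
    (hH : ∀ j : ℤ, ∀ x ∈ g j, ⁅H, x⁆ = (j : F) • x) {j : ℤ} {x : L}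
    (hx : ⁅H, x⁆ = (j : F) • x) : x ∈ g j := by
  let E : ℤ → Submodule F L := fun i => (LieAlgebra.ad F L H).eigenspace (i : F)
  have hE : iSupIndep E :=
    (Module.End.eigenspaces_iSupIndep (LieAlgebra.ad F L H)).comp Int.cast_injective
  have hle : g ≤ E := fun i y hy => Module.End.mem_eigenspace_iff.2 (hH i y hy)
  have heq : g = E := (hE.le_iff_eq_of_iSup_eq_top hdecomp.submodule_iSup_eq_top).1 hle
  rw [heq]
  exact Module.End.mem_eigenspace_iff.2 hx

/-- A Lie algebra automorphism commuting with `ad H` preserves the grading. -/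
theorem map_eq_of_lie_comm [CharZero F] {g : ℤ → Submodule F L}
    (hdecomp : DirectSum.IsInternal g) {H : L}
    (hH : ∀ j : ℤ, ∀ x ∈ g j, ⁅H, x⁆ = (j : F) • x) (φ : L ≃ₗ⁅F⁆ L)
    (hφ : ∀ x, φ ⁅H, x⁆ = ⁅H, φ x⁆) (j : ℤ) :
    (g j).map (φ : L →ₗ⁅F⁆ L).toLinearMap = g j := by
  apply le_antisymm
  · rintro _ ⟨x, hx, rfl⟩
    refine mem_of_lie_eq_smul hdecomp hH ?_
    change ⁅H, φ x⁆ = (j : F) • φ x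
    rw [← hφ, hH j x hx, map_smul]
  · intro x hx
    refine ⟨φ.symm x, mem_of_lie_eq_smul hdecomp hH ?_, φ.apply_symm_apply x⟩
    apply φ.injective
    change φ _ = φ _
    rw [hφ, map_smul, φ.apply_symm_apply, hH j x hx]

theorem IsGoodElement.map {g : ℤ → Submodule F L} {e : L} (he : IsGoodElement g e)
    (φ : L ≃ₗ⁅F⁆ L) (hφ : ∀ j : ℤ, (g j).map (φ : L →ₗ⁅F⁆ L).toLinearMap = g j) :
    IsGoodElement g (φ e) := by
  have hm : ∀ j, ∀ x ∈ g j, φ x ∈ g j := fun j x hx => by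
    rw [← hφ j]; exact ⟨x, hx, rfl⟩
  have hs : ∀ j, ∀ x ∈ g j, ∃ y ∈ g j, φ y = x := fun j x hx => by
    rw [← hφ j] at hx; exact hx
  obtain ⟨h2, hinj, hsurj⟩ := he
  refine ⟨hm 2 e h2, fun j hj x hx h0 => ?_, fun j hj y hy => ?_⟩
  · obtain ⟨x, hx', rfl⟩ := hs j x hx
    rw [← LieEquiv.map_lie] at h0
    have h1 : ⁅e, x⁆ = 0 := φ.injective (h0.trans (map_zero φ).symm)
    rw [hinj j hj x hx' h1, map_zero]
  · obtain ⟨y, hy', rfl⟩ := hs _ y hy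
    obtain ⟨x, hx, rfl⟩ := hsurj j hj y hy'
    exact ⟨φ x, hm j x hx, (LieEquiv.map_lie φ e x).symm⟩

variable {ι : Type*}

/-- The coordinates of `exp (t D) v`, as formal power series in `t`. -/
noncomputable def expSeries (b : Module.Basis ι F L) (D : LieDerivation F L L) (q : ι) :
    L →ₗ[F] PowerSeries F where
  toFun v := PowerSeries.mk fun n => ((n.factorial : F))⁻¹ * b.repr ((D : L →ₗ[F] L) ^ n • v) q
  map_add' v w := by ext n; simp [mul_add]
  map_smul' c v := by ext n; simp; ring

theorem coeff_expSeries (b : Module.Basis ι F L) (D : LieDerivation F L L) (q : ι) (v : L)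
    (n : ℕ) : PowerSeries.coeff n (expSeries b D q v) =
      ((n.factorial : F))⁻¹ * b.repr (D^[n] v) q := by
  simp [expSeries, Module.End.pow_apply]

variable [Fintype ι]

open MvPolynomial in
/-- Equations, in matrix coordinates, for a linear endomorphism to respect the bracket
and commute with `ad H`. -/
noncomputable def gradedEndEquations (b : Module.Basis ι F L) (H : L) :
    Set (MvPolynomial (ι × ι) F) :=
  (Set.range fun s : ι × ι × ι =>
    ∑ k, C (b.repr ⁅b s.1, b s.2.1⁆ k) * X (s.2.2, k) -
      ∑ k, ∑ l, X (k, s.1) * X (l, s.2.1) * C (b.repr ⁅b k, b l⁆ s.2.2)) ∪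
  (Set.range fun s : ι × ι =>
    ∑ k, C (b.repr ⁅H, b s.1⁆ k) * X (s.2, k) -
      ∑ k, X (k, s.1) * C (b.repr ⁅H, b k⁆ s.2))

theorem linearMap_eq_sum (b : Module.Basis ι F L) {M : Type*} [AddCommGroup M] [Module F M]
    (A : L →ₗ[F] M) (v : L) : A v = ∑ k, b.repr v k • A (b k) := by
  conv_lhs => rw [← b.sum_repr v, map_sum]
  simp only [map_smul]

theorem repr_apply_eq_sum (b : Module.Basis ι F L) (A : L →ₗ[F] L) (v : L) (q : ι) :
    b.repr (A v) q = ∑ k, b.repr v k * b.repr (A (b k)) q :=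
  linearMap_eq_sum b (b.coord q ∘ₗ A) v

theorem repr_lie_eq_sum (b : Module.Basis ι F L) (v w : L) (q : ι) :
    b.repr ⁅v, w⁆ q = ∑ k, ∑ l, b.repr v k * b.repr w l * b.repr ⁅b k, b l⁆ q := by
  rw [← lie_skew, map_neg, Finsupp.neg_apply,
    show ⁅w, v⁆ = LieAlgebra.ad F L w v from rfl, repr_apply_eq_sum, ← Finset.sum_neg_distrib]
  refine Finset.sum_congr rfl fun k _ => ?_
  rw [LieAlgebra.ad_apply, ← lie_skew, map_neg, Finsupp.neg_apply, mul_neg, neg_neg,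
    show ⁅b k, w⁆ = LieAlgebra.ad F L (b k) w from rfl, repr_apply_eq_sum, Finset.mul_sum]
  simp only [LieAlgebra.ad_apply, mul_assoc]

theorem aeval_expSeries_eq_zero [CharZero F] (b : Module.Basis ι F L) {H : L}
    (D : LieDerivation F L L) (hD : ∀ x, D ⁅H, x⁆ = ⁅H, D x⁆)
    (s : MvPolynomial (ι × ι) F) (hs : s ∈ gradedEndEquations b H) :
    MvPolynomial.aeval (fun r : ι × ι => expSeries b D r.1 (b r.2)) s = 0 := by
  have hDn : ∀ (n : ℕ) x, D^[n] ⁅H, x⁆ = ⁅H, D^[n] x⁆ := by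
    intro n x
    induction n with
    | zero => rfl
    | succ n ih => rw [Function.iterate_succ_apply', Function.iterate_succ_apply', ih, hD]
  rcases hs with ⟨⟨i, j, q⟩, rfl⟩ | ⟨⟨i, q⟩, rfl⟩
  · simp only [map_sub, map_sum, map_mul, MvPolynomial.aeval_X, MvPolynomial.aeval_C,
      ← Algebra.smul_def]
    rw [← linearMap_eq_sum b (expSeries b D q), sub_eq_zero]
    ext n
    rw [coeff_expSeries, LieDerivation.iterate_apply_lie]
    simp only [map_sum, PowerSeries.coeff_mul_C, PowerSeries.algebraMap_apply,
      Algebra.algebraMap_self, RingHom.id_apply]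
    simp only [PowerSeries.coeff_mul, coeff_expSeries, map_nsmul,
      Finsupp.coe_finsetSum, Finset.sum_apply, Finset.mul_sum, Finset.sum_mul]
    conv_rhs => enter [2, k]; rw [Finset.sum_comm]
    rw [Finset.sum_comm]
    refine Finset.sum_congr rfl fun ⟨c, d⟩ hcd => ?_
    replace hcd : c + d = n := Finset.HasAntidiagonal.mem_antidiagonal.1 hcd
    subst hcd
    rw [Finsupp.smul_apply, repr_lie_eq_sum, nsmul_eq_mul, Nat.cast_add_choose, Finset.mul_sum,
      Finset.mul_sum]
    refine Finset.sum_congr rfl fun k _ => ?_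
    rw [Finset.mul_sum, Finset.mul_sum]
    refine Finset.sum_congr rfl fun l _ => ?_
    have h1 : ((c + d).factorial : F) ≠ 0 := Nat.cast_ne_zero.2 (Nat.factorial_ne_zero _)
    have h2 : (c.factorial : F) ≠ 0 := Nat.cast_ne_zero.2 (Nat.factorial_ne_zero _)
    have h3 : (d.factorial : F) ≠ 0 := Nat.cast_ne_zero.2 (Nat.factorial_ne_zero _)
    simp only []
    field_simp
  · simp only [map_sub, map_sum, map_mul, MvPolynomial.aeval_X, MvPolynomial.aeval_C,
      ← Algebra.smul_def]
    rw [← linearMap_eq_sum b (expSeries b D q), sub_eq_zero]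
    ext n
    rw [coeff_expSeries, hDn]
    have := repr_apply_eq_sum b (LieAlgebra.ad F L H) (D^[n] (b i)) q
    simp only [LieAlgebra.ad_apply] at this
    rw [this, Finset.mul_sum]
    simp only [map_sum, PowerSeries.coeff_mul_C, PowerSeries.algebraMap_apply,
      Algebra.algebraMap_self, RingHom.id_apply, coeff_expSeries, mul_assoc]

/-- An invertible matrix solving the equations comes from a Lie algebra automorphism
commuting with `ad H`. -/
theorem exists_lieEquiv_of_equations [DecidableEq ι] (b : Module.Basis ι F L) {H : L}
    (x : ι × ι → F)
    (hx : ∀ s ∈ gradedEndEquations b H, MvPolynomial.aeval x s = 0)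
    (hdet : (Matrix.of fun q p => x (q, p)).det ≠ 0) :
    ∃ φ : L ≃ₗ⁅F⁆ L, (∀ v, φ ⁅H, v⁆ = ⁅H, φ v⁆) ∧
      ∀ v q, b.repr (φ v) q = ∑ k, b.repr v k * x (q, k) := by
  let A : L →ₗ[F] L := Matrix.toLin b b (Matrix.of fun q p => x (q, p))
  have hA : ∀ p q, b.repr (A (b p)) q = x (q, p) := by
    intro p q
    simp [A, Matrix.toLin_self, Finsupp.single_apply]
  have hbr : ∀ v w, A ⁅v, w⁆ = ⁅A v, A w⁆ := by
    intro v w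
    let B1 : L →ₗ[F] L →ₗ[F] L := (LieModule.toEnd F L L : L →ₗ[F] L →ₗ[F] L).compr₂ A
    let B2 : L →ₗ[F] L →ₗ[F] L := (LieModule.toEnd F L L : L →ₗ[F] L →ₗ[F] L).compl₁₂ A A
    have : B1 = B2 := by
      refine b.ext fun i => b.ext fun j => b.ext_elem fun q => ?_
      have h := hx _ (Or.inl ⟨(i, j, q), rfl⟩)
      simp only [map_sub, map_sum, map_mul, MvPolynomial.aeval_X, MvPolynomial.aeval_C,
        sub_eq_zero, Algebra.algebraMap_self, RingHom.id_apply] at h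
      change b.repr (A ⁅b i, b j⁆) q = b.repr ⁅A (b i), A (b j)⁆ q
      rw [repr_apply_eq_sum, repr_lie_eq_sum]
      simpa only [hA] using h
    exact LinearMap.congr_fun₂ this v w
  have hcomm : ∀ v, A ⁅H, v⁆ = ⁅H, A v⁆ := by
    intro v
    have : A ∘ₗ (LieAlgebra.ad F L H : L →ₗ[F] L) = (LieAlgebra.ad F L H : L →ₗ[F] L) ∘ₗ A := by
      refine b.ext fun i => b.ext_elem fun q => ?_
      have h := hx _ (Or.inr ⟨(i, q), rfl⟩)
      simp only [map_sub, map_sum, map_mul, MvPolynomial.aeval_X, MvPolynomial.aeval_C,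
        sub_eq_zero, Algebra.algebraMap_self, RingHom.id_apply] at h
      rw [LinearMap.comp_apply, LinearMap.comp_apply, repr_apply_eq_sum,
        repr_apply_eq_sum b _ (A (b i))]
      simpa only [hA, LieAlgebra.ad_apply] using h
    exact LinearMap.congr_fun this v
  have hbij : Function.Bijective A := by
    exact (LinearEquiv.ofIsUnitDet (v := b) (v' := b) (f := A)
      (by rw [LinearMap.toMatrix_toLin]; exact hdet.isUnit)).bijective
  refine ⟨LieEquiv.ofBijective { A with map_lie' := fun {v w} => hbr v w } hbij, hcomm,
    fun v q => ?_⟩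
  change b.repr (A v) q = _
  rw [repr_apply_eq_sum]
  simp only [hA]

/-- A polynomial vanishing on the orbit of `v` under the automorphisms commuting with `ad H`
vanishes on `exp (t D) v` for each derivation `D` commuting with `ad H`. -/
theorem aeval_expSeries_orbit [CharZero F] [IsAlgClosed F] (b : Module.Basis ι F L)
    {H : L} (D : LieDerivation F L L) (hD : ∀ x, D ⁅H, x⁆ = ⁅H, D x⁆) (v : L)
    (p : MvPolynomial ι F)
    (hp : ∀ φ : L ≃ₗ⁅F⁆ L, (∀ x, φ ⁅H, x⁆ = ⁅H, φ x⁆) →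
      MvPolynomial.eval (fun i => b.repr (φ v) i) p = 0) :
    MvPolynomial.aeval (fun q => expSeries b D q v) p = 0 := by
  classical
  let f : MvPolynomial (ι × ι) F := MvPolynomial.aeval
      (fun q => ∑ k, MvPolynomial.C (b.repr v k) * MvPolynomial.X (q, k)) p
  let d : MvPolynomial (ι × ι) F := (Matrix.of fun q p => MvPolynomial.X (q, p)).det
  have hf : ∀ {K : Type _} [CommRing K] [Algebra F K] (a : ι × ι → K),
      MvPolynomial.aeval a f =
        MvPolynomial.aeval (fun q => ∑ k, b.repr v k • a (q, k)) p := by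
    intro K _ _ a
    rw [← AlgHom.comp_apply, MvPolynomial.comp_aeval]
    simp [Algebra.smul_def]
  have hd : ∀ {K : Type _} [CommRing K] [Algebra F K] (a : ι × ι → K),
      MvPolynomial.aeval a d = (Matrix.of fun q p => a (q, p)).det := by
    intro K _ _ a
    rw [AlgHom.map_det]
    congr 1
    ext q p
    simp
  let a : ι × ι → PowerSeries F := fun r => expSeries b D r.1 (b r.2)
  have key : MvPolynomial.aeval a (f * d) = 0 := by
    refine MvPolynomial.aeval_eq_zero_of_forall_zeroLocus (gradedEndEquations b H) (f * d)
      (fun x hx => ?_) a (aeval_expSeries_eq_zero b D hD)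
    rw [map_mul, hd]
    by_cases hdet : (Matrix.of fun q p => x (q, p)).det = 0
    · rw [hdet, mul_zero]
    · obtain ⟨φ, hφ, hrepr⟩ := exists_lieEquiv_of_equations b x hx hdet
      have := hp φ hφ
      simp only [hrepr] at this
      rw [hf, MvPolynomial.aeval_eq_eval]
      simp only [smul_eq_mul]
      rw [this, zero_mul]
  rw [map_mul, hf, hd] at key
  have hne : (Matrix.of fun q p => a (q, p)).det ≠ 0 := by
    intro h0
    have h1 := congrArg (PowerSeries.constantCoeff (R := F)) h0
    rw [RingHom.map_det] at h1
    have h2 : (PowerSeries.constantCoeff (R := F)).mapMatrix (Matrix.of fun q p => a (q, p)) =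
        1 := by
      ext q p
      have := coeff_expSeries b D q (b p) 0
      rw [PowerSeries.coeff_zero_eq_constantCoeff_apply] at this
      simp [a, this, Matrix.one_apply, Finsupp.single_apply, eq_comm]
    rw [h2, Matrix.det_one, map_zero] at h1
    exact one_ne_zero h1
  have := (mul_eq_zero.1 key).resolve_right hne
  simpa only [a, ← linearMap_eq_sum b (expSeries b D _) v] using this

/-- Infinitesimal form of invariance: derivatives along `D v` also vanish. -/
theorem eval_dirDeriv_orbit [CharZero F] [IsAlgClosed F] (b : Module.Basis ι F L)
    {H : L} (D : LieDerivation F L L) (hD : ∀ x, D ⁅H, x⁆ = ⁅H, D x⁆) (v : L)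
    (p : MvPolynomial ι F)
    (hp : ∀ φ : L ≃ₗ⁅F⁆ L, (∀ x, φ ⁅H, x⁆ = ⁅H, φ x⁆) →
      MvPolynomial.eval (fun i => b.repr (φ v) i) p = 0) :
    MvPolynomial.eval (fun i => b.repr v i)
      (MvPolynomial.dirDeriv (fun i => b.repr (D v) i) p) = 0 := by
  have h := MvPolynomial.coeff_one_aeval (fun q => expSeries b D q v) p
  rw [aeval_expSeries_orbit b D hD v p hp, map_zero] at h
  have h0 : ∀ q, PowerSeries.constantCoeff (expSeries b D q v) = b.repr v q := fun q => by
    rw [← PowerSeries.coeff_zero_eq_constantCoeff_apply, coeff_expSeries]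
    simp
  simp only [h0, coeff_expSeries] at h
  simpa using h.symm

/-- Polynomial functions are given by polynomials in coordinates. -/
theorem exists_mvPolynomial_of_mem_adjoin (b : Module.Basis ι F L) {P : L → F}
    (hP : P ∈ Algebra.adjoin F (Set.range fun φ : Module.Dual F L => (φ : L → F))) :
    ∃ p : MvPolynomial ι F, ∀ x, P x = MvPolynomial.eval (fun i => b.repr x i) p := by
  induction hP using Algebra.adjoin_induction with
  | mem P h =>
    obtain ⟨φ, rfl⟩ := h
    refine ⟨∑ k, MvPolynomial.X k * MvPolynomial.C (φ (b k)), fun x => ?_⟩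
    simpa using linearMap_eq_sum b φ x
  | algebraMap r => exact ⟨MvPolynomial.C r, fun x => by simp⟩
  | add P Q _ _ hp hq =>
    obtain ⟨p, hp⟩ := hp
    obtain ⟨q, hq⟩ := hq
    exact ⟨p + q, fun x => by simp [hp, hq]⟩
  | mul P Q _ _ hp hq =>
    obtain ⟨p, hp⟩ := hp
    obtain ⟨q, hq⟩ := hq
    exact ⟨p * q, fun x => by simp [hp, hq]⟩

end Graded

/-- the set of good elements in `g 2` is stable under the group `G₀` of
Lie algebra automorphisms preserving the grading, and the `G₀`-orbit of a good element
is Zariski dense in `g 2` (every polynomial function, i.e. element of the algebra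
generated by linear functionals, vanishing on the orbit vanishes on `g 2`). -/
theorem stmt1 {F L : Type*} [Field F] [CharZero F] [IsAlgClosed F]
    [LieRing L] [LieAlgebra F L] [FiniteDimensional F L]
    (g : ℤ → Submodule F L)
    (hdecomp : DirectSum.IsInternal g)
    (hgrade : ∀ i j : ℤ, ∀ x ∈ g i, ∀ y ∈ g j, ⁅x, y⁆ ∈ g (i + j))
    (H : L) (hH : ∀ j : ℤ, ∀ x ∈ g j, ⁅H, x⁆ = (j : F) • x)
    (e : L) (he : IsGoodElement g e)
    (hsurj0 : ∀ y ∈ g 2, ∃ x ∈ g 0, ⁅e, x⁆ = y) :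
    (∀ φ : L ≃ₗ⁅F⁆ L,
        (∀ j : ℤ, (g j).map (φ : L →ₗ⁅F⁆ L).toLinearMap = g j) →
        IsGoodElement g (φ e)) ∧
    (∀ P : L → F,
        P ∈ Algebra.adjoin F (Set.range fun φ : Module.Dual F L => (φ : L → F)) →
        (∀ φ : L ≃ₗ⁅F⁆ L,
          (∀ j : ℤ, (g j).map (φ : L →ₗ⁅F⁆ L).toLinearMap = g j) → P (φ e) = 0) →
        ∀ y ∈ g 2, P y = 0) := by
  refine ⟨fun φ hφ => he.map φ hφ, fun P hP hvan y hy => ?_⟩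
  let b := Module.finBasis F L
  obtain ⟨p, hp⟩ := exists_mvPolynomial_of_mem_adjoin b hP
  let v : Fin (Module.finrank F L) → F := fun i => b.repr (y - e) i
  have hvg : y - e ∈ g 2 := sub_mem hy he.1
  have hstep : ∀ q : MvPolynomial (Fin (Module.finrank F L)) F,
      (∀ φ : L ≃ₗ⁅F⁆ L, (∀ x, φ ⁅H, x⁆ = ⁅H, φ x⁆) →
        MvPolynomial.eval (fun i => b.repr (φ e) i) q = 0) →
      ∀ φ : L ≃ₗ⁅F⁆ L, (∀ x, φ ⁅H, x⁆ = ⁅H, φ x⁆) →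
        MvPolynomial.eval (fun i => b.repr (φ e) i) (MvPolynomial.dirDeriv v q) = 0 := by
    intro q hq φ hφ
    obtain ⟨x, hx, hxv⟩ :=
      (he.map φ (map_eq_of_lie_comm hdecomp hH φ hφ)).2.2 0 (by norm_num) (y - e)
        (by simpa using hvg)
    have hHx : ⁅H, x⁆ = 0 := by rw [hH 0 x hx]; simp
    let D : LieDerivation F L L := LieDerivation.ad F L (-x)
    have hDv : D (φ e) = y - e := by
      rw [LieDerivation.ad_apply_apply, neg_lie, lie_skew, hxv]
    have hD : ∀ z, D ⁅H, z⁆ = ⁅H, D z⁆ := by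
      intro z
      rw [LieDerivation.ad_apply_apply, LieDerivation.ad_apply_apply, leibniz_lie H, lie_neg, hHx]
      simp
    have := eval_dirDeriv_orbit b D hD (φ e) q fun ψ hψ => by
      have := hq (φ.trans ψ) fun z => by
        change ψ (φ ⁅H, z⁆) = ⁅H, ψ (φ z)⁆
        rw [hφ, hψ]
      exact this
    rw [hDv] at this
    exact this
  have hall : ∀ n : ℕ, ∀ φ : L ≃ₗ⁅F⁆ L, (∀ x, φ ⁅H, x⁆ = ⁅H, φ x⁆) →
      MvPolynomial.eval (fun i => b.repr (φ e) i) ((MvPolynomial.dirDeriv v)^[n] p) = 0 := by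
    intro n
    induction n with
    | zero =>
      intro φ hφ
      rw [Function.iterate_zero_apply, ← hp]
      exact hvan φ (map_eq_of_lie_comm hdecomp hH φ hφ)
    | succ n ih =>
      rw [Function.iterate_succ_apply']
      exact hstep _ ih
  have h := MvPolynomial.eval_add_eq_zero_of_iterate_dirDeriv (fun i => b.repr e i) v p
    fun n => hall n LieEquiv.refl fun _ => rfl
  rw [hp, ← h]
  congr 2
  ext i
  simp [v]
end

section
/- Let g = ⊕_{j∈Z} g_j be a Z-graded semisimple Lie algebra over an algebraically closed field of characteristic 0, and let e ∈ g_2 be nonzero. Then there exist h ∈ g_0 and f ∈ g_{-2} such that {e, h, f} is an sl_2-triple, i.e., [h,e] = 2e, [e,f] = h, [h,f] = -2f. -/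
namespace GradedJacobsonMorozov

open Module LieAlgebra

section Associative

variable {F A : Type*} [Field F] [CharZero F] [Ring A] [Algebra F A]

/-- The Leibniz rule for iterates of a commutator, truncated because `X * Z - Z * X` commutes
with `X`. -/
lemma iterate_commutator_mul (X Z T : A) (hT : X * Z - Z * X = T) (hTX : X * T = T * X)
    (δ : A →ₗ[F] A) (hδ : ∀ a, δ a = X * a - a * X) (W : A) (k : ℕ) :
    (δ ^ (k + 1)) (Z * W) =
      Z * (δ ^ (k + 1)) W + ((k : F) + 1) • (T * (δ ^ k) W) := by
  have hZ (a : A) : δ (Z * a) = Z * δ a + T * a := by rw [hδ, hδ, ← hT]; noncomm_ring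
  have hTmul (a : A) : δ (T * a) = T * δ a := by
    rw [hδ, hδ, mul_sub, ← mul_assoc, hTX]; noncomm_ring
  induction k with
  | zero => simp [hZ]
  | succ k ih =>
    rw [pow_succ' δ (k + 1), Module.End.mul_apply, ih, map_add, map_smul, hZ, hTmul,
      ← Module.End.mul_apply, ← Module.End.mul_apply, ← pow_succ', ← pow_succ']
    push_cast
    module

lemma iterate_commutator_pow (X Z T : A) (hT : X * Z - Z * X = T) (hTX : X * T = T * X)
    (δ : A →ₗ[F] A) (hδ : ∀ a, δ a = X * a - a * X) (n : ℕ) :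
    (δ ^ n) (Z ^ n) = (n.factorial : F) • T ^ n ∧ (δ ^ (n + 1)) (Z ^ n) = 0 := by
  induction n with
  | zero => simp [hδ]
  | succ n ih =>
    have hpow : (δ ^ (n + 1)) (Z ^ (n + 1)) = ((n + 1).factorial : F) • T ^ (n + 1) := by
      rw [pow_succ' Z, iterate_commutator_mul X Z T hT hTX δ hδ, ih.1, ih.2, mul_zero, zero_add,
        mul_smul_comm, ← pow_succ', smul_smul, Nat.factorial_succ]
      push_cast
      rfl
    have hcomm : δ (T ^ (n + 1)) = 0 := by
      rw [hδ, sub_eq_zero]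
      exact Commute.pow_right hTX (n + 1)
    refine ⟨hpow, ?_⟩
    rw [pow_succ', Module.End.mul_apply, hpow, map_smul, hcomm, smul_zero]

attribute [local instance] LieRing.ofAssociativeRing in
/-- A commutator `X * Z - Z * X` with `X` nilpotent that commutes with `X` is nilpotent. -/
lemma isNilpotent_commutator (F : Type*) {A : Type*} [Field F] [CharZero F] [Ring A]
    [Algebra F A] (X Z T : A) (hX : IsNilpotent X)
    (hT : X * Z - Z * X = T) (hTX : X * T = T * X) : IsNilpotent T := by
  obtain ⟨n, hn⟩ := LieAlgebra.ad_nilpotent_of_nilpotent (R := F) hX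
  refine ⟨n, ?_⟩
  have h := (iterate_commutator_pow X Z T hT hTX (ad F A X)
    (fun a ↦ by rw [ad_apply, LieRing.of_associative_ring_bracket]) n).1
  rw [hn, LinearMap.zero_apply] at h
  exact (smul_eq_zero.mp h.symm).resolve_left (by exact_mod_cast n.factorial_ne_zero)

/-- The `sl₂` commutation formula for powers of the raising operator. -/
lemma pow_mul_sub_mul_pow (E H Y : A) (hEY : E * Y - Y * E = H)
    (hHE : H * E - E * H = (2 : F) • E) (k : ℕ) :
    E ^ (k + 1) * Y - Y * E ^ (k + 1) =
      ((k : F) + 1) • (H * E ^ k - (k : F) • E ^ k) := by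
  induction k with
  | zero => simp [hEY]
  | succ k ih =>
    have hsplit : E ^ (k + 2) * Y - Y * E ^ (k + 2) =
        E * (E ^ (k + 1) * Y - Y * E ^ (k + 1)) + (E * Y - Y * E) * E ^ (k + 1) := by
      rw [pow_succ' E (k + 1)]; noncomm_ring
    have hEH : E * H = H * E - (2 : F) • E := by rw [← hHE]; abel
    rw [hsplit, ih, hEY, mul_smul_comm, mul_sub, mul_smul_comm, ← mul_assoc, hEH, sub_mul,
      smul_mul_assoc, mul_assoc, ← pow_succ']
    push_cast
    module

end Associative

section Operators

variable {F V : Type*} [Field F] [CharZero F] [AddCommGroup V] [Module F V]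

/-- An operator raising the eigenvalues of another one by a nonzero constant is nilpotent. -/
lemma isNilpotent_of_commutator_eq_smul [FiniteDimensional F V] (D X : End F V) (c : F)
    (hc : c ≠ 0) (h : D * X - X * D = c • X) : IsNilpotent X := by
  let δ : End F (End F V) := LinearMap.mulLeft F D - LinearMap.mulRight F D
  have hδ (n : ℕ) : δ (X ^ n) = ((n : F) * c) • X ^ n := by
    induction n with
    | zero => simp [δ]
    | succ n ih =>
      have hsplit : δ (X ^ (n + 1)) = δ (X ^ n) * X + X ^ n * (D * X - X * D) := by
        simp only [δ, LinearMap.sub_apply, LinearMap.mulLeft_apply, LinearMap.mulRight_apply,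
          pow_succ]
        noncomm_ring
      rw [hsplit, ih, h, smul_mul_assoc, mul_smul_comm, ← pow_succ]
      push_cast
      module
  by_contra hX
  have heig (n : ℕ) : δ.HasEigenvalue ((n : F) * c) :=
    End.hasEigenvalue_of_hasEigenvector
      ⟨End.mem_eigenspace_iff.mpr (hδ n), fun h0 ↦ hX ⟨n, h0⟩⟩
  have hinj : Function.Injective fun n : ℕ ↦ (n : F) * c := fun m n hmn ↦
    Nat.cast_injective (mul_right_cancel₀ hc hmn)
  exact Set.infinite_of_injective_forall_mem hinj heig (End.finite_hasEigenvalue δ)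

/-- The operator `H` has no negative integer eigenvalues on the kernel of `E`. -/
lemma eq_zero_of_apply_eq_neg_smul (E H Y : End F V) (hE : IsNilpotent E)
    (hEY : E * Y - Y * E = H) (hHE : H * E - E * H = (2 : F) • E) (m : ℕ) (hm : m ≠ 0)
    {x : V} (hEx : E x = 0) (hHx : H x = -((m : F) • x)) : x = 0 := by
  have hrange (k : ℕ) : ∃ y, (E ^ k) y = x := by
    induction k with
    | zero => exact ⟨x, rfl⟩
    | succ k ih =>
      obtain ⟨y, hy⟩ := ih
      have h := LinearMap.congr_fun (pow_mul_sub_mul_pow E H Y hEY hHE k) y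
      simp only [LinearMap.sub_apply, LinearMap.smul_apply, Module.End.mul_apply, hy, hHx] at h
      rw [pow_succ' E k, Module.End.mul_apply E (E ^ k) y, hy, hEx, map_zero, sub_zero] at h
      have hk : ((k : F) + 1) * ((m : F) + k) ≠ 0 := by
        exact_mod_cast mul_ne_zero k.succ_ne_zero (by omega : m + k ≠ 0)
      refine ⟨-(((k : F) + 1) * ((m : F) + k))⁻¹ • Y y, ?_⟩
      rw [map_smul, pow_succ' E k, h, neg_smul, ← smul_neg, inv_smul_eq_iff₀ hk]
      module
  obtain ⟨n, hn⟩ := hE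
  obtain ⟨y, rfl⟩ := hrange n
  rw [hn, LinearMap.zero_apply]

end Operators

section Graded

variable {F L : Type*} [Field F] [LieRing L] [LieAlgebra F L]
  {g : ℤ → Submodule F L}

lemma induction_homogeneous (hg : iSup g = ⊤) {p : L → Prop} (hp0 : p 0)
    (hadd : ∀ x y, p x → p y → p (x + y)) (hmem : ∀ i, ∀ x ∈ g i, p x) (x : L) : p x :=
  Submodule.iSup_induction g (motive := p) (hg ▸ Submodule.mem_top) hmem hp0 hadd

/-- A grading of a Lie algebra with nondegenerate Killing form is the eigenspace grading of an
inner derivation. -/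
lemma exists_grading_element [FiniteDimensional F L] [IsKilling F L]
    (hdecomp : DirectSum.IsInternal g)
    (hgrade : ∀ i j : ℤ, ∀ x ∈ g i, ∀ y ∈ g j, ⁅x, y⁆ ∈ g (i + j)) :
    ∃ d : L, ∀ i, ∀ x ∈ g i, ⁅d, x⁆ = (i : F) • x := by
  let _ := hdecomp.chooseDecomposition
  have hg := hdecomp.submodule_iSup_eq_top
  let D : L →ₗ[F] L := DirectSum.toModule F ℤ L (fun i ↦ (i : F) • (g i).subtype) ∘ₗ
    (DirectSum.decomposeLinearEquiv g).toLinearMap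
  have hD : ∀ i, ∀ x ∈ g i, D x = (i : F) • x := by
    intro i x hx
    lift x to g i using hx
    simp [D]
  have hleibniz (x y : L) : D ⁅x, y⁆ = ⁅x, D y⁆ - ⁅y, D x⁆ := by
    induction x using induction_homogeneous hg with
    | hp0 => simp
    | hadd x x' hx hx' => simp only [add_lie, map_add, lie_add, hx, hx']; abel
    | hmem i x hx =>
      induction y using induction_homogeneous hg with
      | hp0 => simp
      | hadd y y' hy hy' => simp only [add_lie, map_add, lie_add, hy, hy']; abel
      | hmem j y hy =>
        rw [hD _ _ (hgrade i j x hx y hy), hD _ _ hx, hD _ _ hy, lie_smul, lie_smul,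
          ← lie_skew x y]
        push_cast
        module
  obtain ⟨d, hd⟩ :=
    LieDerivation.IsKilling.exists_eq_ad (R := F) (⟨D, hleibniz⟩ : LieDerivation F L L)
  refine ⟨d, fun i x hx ↦ ?_⟩
  rw [← hD i x hx]
  simpa using DFunLike.congr_fun hd x

lemma ad_mul_sub_mul_ad (x y : L) :
    ad F L x * ad F L y - ad F L y * ad F L x = ad F L ⁅x, y⁆ :=
  LinearMap.ext fun z ↦ by simp

lemma killingForm_lie_apply (x y z : L) :
    killingForm F L ⁅x, y⁆ z = -killingForm F L y ⁅x, z⁆ := by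
  rw [← lie_skew, map_neg, LinearMap.neg_apply, LieModule.traceForm_apply_lie_apply]

/-- With respect to the grading given by `d`, elements of degree `-2` killed by `(ad e) ^ 2`
are orthogonal to `e`. -/
lemma killingForm_eq_zero_of_lie_lie_eq_zero [CharZero F] [FiniteDimensional F L] {d e z : L}
    (hde : ⁅d, e⁆ = (2 : F) • e) (hdz : ⁅d, z⁆ = -((2 : F) • z)) (hz : ⁅e, ⁅e, z⁆⁆ = 0) :
    killingForm F L z e = 0 := by
  have had := ad_mul_sub_mul_ad (F := F) (L := L)
  have he : IsNilpotent (ad F L e) :=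
    isNilpotent_of_commutator_eq_smul (ad F L d) (ad F L e) 2 two_ne_zero
      (by rw [had, hde, map_smul])
  have hw : IsNilpotent (ad F L ⁅e, z⁆) :=
    isNilpotent_commutator F (ad F L e) (ad F L z) _ he (had e z)
      (sub_eq_zero.mp (by rw [had, hz, map_zero]))
  have hdw : ⁅d, ⁅e, z⁆⁆ = 0 := by
    rw [leibniz_lie, hde, hdz, lie_neg, lie_smul, smul_lie, add_neg_cancel]
  have hcomm : Commute (ad F L d) (ad F L ⁅e, z⁆) :=
    sub_eq_zero.mp (by rw [had, hdw, map_zero])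
  have htrace : killingForm F L d ⁅e, z⁆ = 0 :=
    (LinearMap.isNilpotent_trace_of_isNilpotent (hcomm.isNilpotent_mul_left hw)).eq_zero
  rw [← LieModule.traceForm_apply_lie_apply, hde, map_smul, LinearMap.smul_apply, smul_eq_mul,
    LieModule.traceForm_comm] at htrace
  exact (mul_eq_zero.mp htrace).resolve_left two_ne_zero

lemma exists_lie_lie_eq [CharZero F] [FiniteDimensional F L] [IsKilling F L]
    (hdecomp : DirectSum.IsInternal g)
    (hgrade : ∀ i j : ℤ, ∀ x ∈ g i, ∀ y ∈ g j, ⁅x, y⁆ ∈ g (i + j))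
    {e : L} (he : e ∈ g 2) : ∃ y ∈ g (-2), ⁅e, ⁅e, y⁆⁆ = e := by
  obtain ⟨d, hd⟩ := exists_grading_element hdecomp hgrade
  have hg := hdecomp.submodule_iSup_eq_top
  let _ := hdecomp.chooseDecomposition
  have hnondeg {y : L} (hy : ∀ i, ∀ x ∈ g i, killingForm F L y x = 0) : y = 0 := by
    have : y ∈ LinearMap.ker (killingForm F L) := by
      refine LinearMap.mem_ker.mpr (LinearMap.ext fun x ↦ ?_)
      induction x using induction_homogeneous hg with
      | hp0 => simp
      | hadd x x' hx hx' => rw [map_add, hx, hx', map_add]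
      | hmem i x hx => exact hy i x hx
    simpa using this
  by_contra! hcon
  have hnot : e ∉ (g (-2)).map (ad F L e * ad F L e) := by
    rintro ⟨y, hy, hye⟩
    exact hcon y hy (by simpa using hye)
  obtain ⟨φ, hφe, hφ⟩ := Submodule.exists_le_ker_of_notMem hnot
  let ψ : L →ₗ[F] F := φ ∘ₗ (g 2).subtype ∘ₗ DirectSum.component F ℤ (fun i ↦ g i) 2 ∘ₗ
    (DirectSum.decomposeLinearEquiv g).toLinearMap
  have hψ (x : L) (hx : x ∈ g 2) : ψ x = φ x := by
    change φ (DirectSum.decompose g x 2) = φ x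
    rw [DirectSum.decompose_of_mem_same g hx]
  have hψ_ne (i : ℤ) (hi : i ≠ 2) (x : L) (hx : x ∈ g i) : ψ x = 0 := by
    change φ (DirectSum.decompose g x 2) = 0
    rw [DirectSum.decompose_of_mem_ne g hx hi, map_zero]
  obtain ⟨z, hz⟩ : ∃ z, killingForm F L z = ψ :=
    LinearMap.range_eq_top.mp (LinearMap.ker_eq_bot_iff_range_eq_top_of_finrank_eq_finrank
      (Subspace.dual_finrank_eq (K := F) (V := L)).symm |>.mp (by simp)) ψ
  have hdz : ⁅d, z⁆ = -((2 : F) • z) := by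
    refine eq_neg_of_add_eq_zero_left (hnondeg fun i x hx ↦ ?_)
    rw [map_add, LinearMap.add_apply, killingForm_lie_apply, map_smul, LinearMap.smul_apply, hz,
      hd i x hx, map_smul]
    obtain rfl | hi := eq_or_ne i 2
    · simp
    · simp [hψ_ne i hi x hx]
  have heez : ⁅e, ⁅e, z⁆⁆ = 0 := by
    refine hnondeg fun i x hx ↦ ?_
    rw [killingForm_lie_apply, killingForm_lie_apply, neg_neg, hz]
    have hmem := hgrade _ _ e he _ (hgrade _ _ e he x hx)
    obtain rfl | hi := eq_or_ne i (-2)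
    · rw [hψ _ hmem]
      exact hφ ⟨x, hx, rfl⟩
    · exact hψ_ne _ (by omega) _ hmem
  have hde : ⁅d, e⁆ = (2 : F) • e := by simpa using hd 2 e he
  exact hφe (by rw [← hψ e he, ← hz, killingForm_eq_zero_of_lie_lie_eq_zero hde hdz heez])

end Graded

end GradedJacobsonMorozov

open GradedJacobsonMorozov in
/-- graded Jacobson–Morozov: in a ℤ-graded semisimple Lie algebra over an
algebraically closed field of characteristic 0, every nonzero `e ∈ g 2` embeds in an
`sl₂`-triple `{e, h, f}` with `h ∈ g 0` and `f ∈ g (-2)`. -/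
theorem stmt2 {F L : Type*} [Field F] [CharZero F] [IsAlgClosed F]
    [LieRing L] [LieAlgebra F L] [FiniteDimensional F L]
    [LieAlgebra.IsSemisimple F L]
    (g : ℤ → Submodule F L)
    (hdecomp : DirectSum.IsInternal g)
    (hgrade : ∀ i j : ℤ, ∀ x ∈ g i, ∀ y ∈ g j, ⁅x, y⁆ ∈ g (i + j))
    (e : L) (he : e ∈ g 2) (hne : e ≠ 0) :
    ∃ h f : L, h ∈ g 0 ∧ f ∈ g (-2) ∧
      ⁅h, e⁆ = (2 : F) • e ∧ ⁅e, f⁆ = h ∧ ⁅h, f⁆ = -((2 : F) • f) := by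
  obtain ⟨d, hd⟩ := exists_grading_element hdecomp hgrade
  obtain ⟨y₀, hy₀, hey₀⟩ := exists_lie_lie_eq hdecomp hgrade he
  obtain ⟨y, hy, hey⟩ : ∃ y ∈ g (-2), ⁅⁅e, y⁆, e⁆ = (2 : F) • e :=
    ⟨-((2 : F) • y₀), (g _).neg_mem ((g _).smul_mem _ hy₀), by
      rw [← lie_skew, lie_neg, lie_neg, neg_neg, lie_smul, lie_smul, hey₀]⟩
  set h := ⁅e, y⁆ with h_def
  have hh : h ∈ g 0 := hgrade 2 (-2) e he y hy
  have hh_mem {x : L} (hx : x ∈ g (-2)) : ⁅h, x⁆ ∈ g (-2) := by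
    simpa using hgrade 0 (-2) h hh x hx
  have had := ad_mul_sub_mul_ad (F := F) (L := L)
  have hnil : IsNilpotent (LieAlgebra.ad F L e) :=
    isNilpotent_of_commutator_eq_smul (LieAlgebra.ad F L d) _ 2 two_ne_zero
      (by rw [had, hd 2 e he, Int.cast_ofNat, map_smul])
  have hstable (x : L) (hx : ⁅e, x⁆ = 0) : ⁅e, ⁅h, x⁆⁆ = 0 := by
    rw [leibniz_lie, ← lie_skew e h, hey, hx, lie_zero, add_zero, neg_lie, smul_lie, hx, smul_zero,
      neg_zero]
  let M : Submodule F L := g (-2) ⊓ LinearMap.ker (LieAlgebra.ad F L e)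
  let S : L →ₗ[F] L := LieAlgebra.ad F L h + (2 : F) • LinearMap.id
  have hS (x : L) : S x = ⁅h, x⁆ + (2 : F) • x := rfl
  have hSM : ∀ x ∈ M, S x ∈ M := by
    rintro x ⟨hx, hex⟩
    refine ⟨(g _).add_mem (hh_mem hx) ((g _).smul_mem _ hx), ?_⟩
    have hex : ⁅e, x⁆ = 0 := hex
    simp [hS, hex, hstable x hex]
  have hinj : Function.Injective (S.restrict hSM) := by
    refine (injective_iff_map_eq_zero _).mpr fun ⟨x, hx⟩ hSx ↦ Subtype.ext ?_
    have hSx : ⁅h, x⁆ + (2 : F) • x = 0 := congrArg Subtype.val hSx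
    exact eq_zero_of_apply_eq_neg_smul _ _ _ hnil (had e y)
      (by rw [had, hey, map_smul]) 2 two_ne_zero hx.2
      (eq_neg_of_add_eq_zero_left hSx)
  have hc : S y ∈ M := by
    refine ⟨(g _).add_mem (hh_mem hy) ((g _).smul_mem _ hy), ?_⟩
    change ⁅e, S y⁆ = 0
    rw [hS, lie_add, leibniz_lie, ← lie_skew e h, hey,
      lie_smul, ← h_def, lie_self, neg_lie, smul_lie, ← h_def]
    simp
  obtain ⟨⟨c, hcM⟩, hSc⟩ := LinearMap.injective_iff_surjective.mp hinj ⟨S y, hc⟩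
  have hSc : S c = S y := congrArg Subtype.val hSc
  have hec : ⁅e, c⁆ = 0 := hcM.2
  refine ⟨h, y - c, hh, (g _).sub_mem hy hcM.1, hey, by rw [lie_sub, hec, sub_zero], ?_⟩
  refine eq_neg_of_add_eq_zero_left ?_
  rw [← hS, map_sub, hSc, sub_self]
end

section
/- Let g be a semisimple Lie algebra with a good Z-grading g = ⊕_j g_j and good element e ∈ g_2. Let H be the grading element and let {e, h, f} be an sl_2-triple with h ∈ g_0, f ∈ g_{-2}. Then z := H - h lies in the center of g^s, the centralizer in g of the subalgebra spanned by {e, h, f}. -/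
/-- The commutation formula `e fⁿ⁺¹ = fⁿ⁺¹ e + (n + 1) fⁿ (h - n)` in a Lie algebra. -/
theorem lie_ad_pow_succ_of_sl2 {F L : Type*} [Field F] [LieRing L] [LieAlgebra F L]
    {e h f : L} (hef : ⁅e, f⁆ = h) (hhf : ⁅h, f⁆ = -((2 : F) • f)) (n : ℕ) (y : L) :
    ⁅e, (LieAlgebra.ad F L f ^ (n + 1)) y⁆ =
      (LieAlgebra.ad F L f ^ (n + 1)) ⁅e, y⁆ +
        ((n : F) + 1) • (LieAlgebra.ad F L f ^ n) (⁅h, y⁆ - (n : F) • y) := by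
  have hpow : ∀ k : ℕ, ⁅h, (LieAlgebra.ad F L f ^ k) y⁆ =
      (LieAlgebra.ad F L f ^ k) ⁅h, y⁆ - (2 * (k : F)) • (LieAlgebra.ad F L f ^ k) y := by
    intro k
    induction k with
    | zero => simp
    | succ k ih =>
      rw [pow_succ', Module.End.mul_apply, Module.End.mul_apply, LieAlgebra.ad_apply,
        LieAlgebra.ad_apply, leibniz_lie, ih, hhf]
      simp only [neg_lie, smul_lie, lie_sub, lie_smul]
      push_cast
      module
  induction n with
  | zero => simp [leibniz_lie e f, hef, add_comm]
  | succ n ih =>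
    rw [pow_succ' _ (n + 1), Module.End.mul_apply, Module.End.mul_apply, LieAlgebra.ad_apply,
      LieAlgebra.ad_apply, leibniz_lie, ih, hef, hpow]
    simp only [lie_add, lie_smul, map_sub, map_smul, lie_sub]
    simp only [pow_succ' _ n, Module.End.mul_apply, LieAlgebra.ad_apply]
    push_cast
    module

/-- A vector killed by an `sl₂`-triple is zero as soon as a nonzero multiple of it is of the form
`⁅e, y⁆` with `y` killed by a power of `ad f`. -/
theorem eq_zero_of_lie_eq_smul_of_sl2_invariant {F L : Type*} [Field F] [CharZero F]
    [LieRing L] [LieAlgebra F L] {e h f x : L} (hhe : ⁅h, e⁆ = (2 : F) • e)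
    (hef : ⁅e, f⁆ = h) (hhf : ⁅h, f⁆ = -((2 : F) • f)) (hx : ⁅h, x⁆ = 0) (fx : ⁅f, x⁆ = 0)
    (n : ℕ) (y : L) (c : F) (hc : c ≠ 0) (hy : ⁅e, y⁆ = c • x)
    (hn : (LieAlgebra.ad F L f ^ n) y = 0) : x = 0 := by
  induction n generalizing y c with
  | zero =>
    obtain rfl : y = 0 := by simpa using hn
    simpa [hc] using hy.symm
  | succ n ih =>
    have hn0 : (n : F) + 1 ≠ 0 := by exact_mod_cast n.succ_ne_zero
    have hn2 : (n : F) + 2 ≠ 0 := by exact_mod_cast (n + 1).succ_ne_zero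
    refine ih (⁅h, y⁆ - (n : F) • y) (-((n : F) + 2) * c)
      (mul_ne_zero (neg_ne_zero.mpr hn2) hc) ?_ ?_
    · have heh : ⁅e, h⁆ = -((2 : F) • e) := by rw [← lie_skew, hhe]
      rw [lie_sub, leibniz_lie, heh, lie_smul, neg_lie, smul_lie, hy, lie_smul, hx]
      module
    · have key := lie_ad_pow_succ_of_sl2 hef hhf n y
      rw [hn, hy, pow_succ, Module.End.mul_apply, LieAlgebra.ad_apply, lie_smul, fx] at key
      simpa [hn0] using key.symm

/-- An element of degree `-2` of a finite-dimensional graded Lie algebra acts nilpotently on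
each homogeneous element. -/
theorem exists_ad_pow_eq_zero_of_mem_neg_two {F L : Type*} [Field F] [LieRing L]
    [LieAlgebra F L] [FiniteDimensional F L] {g : ℤ → Submodule F L}
    (hind : iSupIndep g)
    (hgrade : ∀ i j : ℤ, ∀ x ∈ g i, ∀ y ∈ g j, ⁅x, y⁆ ∈ g (i + j))
    {f y : L} (hf : f ∈ g (-2)) {m : ℤ} (hy : y ∈ g m) :
    ∃ n : ℕ, (LieAlgebra.ad F L f ^ n) y = 0 := by
  have hmem : ∀ n : ℕ, (LieAlgebra.ad F L f ^ n) y ∈ g (m - 2 * n) := by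
    intro n
    induction n with
    | zero => simpa using hy
    | succ n ih =>
      rw [pow_succ', Module.End.mul_apply, LieAlgebra.ad_apply]
      have := hgrade _ _ f hf _ ih
      convert this using 2
      push_cast
      ring
  have hfin : {j : ℤ | g j ≠ ⊥}.Finite := WellFoundedGT.finite_ne_bot_of_iSupIndep hind
  by_contra! hne
  refine Set.infinite_of_injective_forall_mem (f := fun n : ℕ ↦ m - 2 * (n : ℤ)) ?_ ?_ hfin
  · intro a b hab
    simp only at hab
    omega
  · intro n hbot
    have := hmem n
    rw [hbot, Submodule.mem_bot] at this
    exact hne n this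

/-- If the integral eigenspaces of an endomorphism span, then an invariant submodule is contained
in any submodule that contains its integral eigenvectors. -/
theorem Module.End.le_of_forall_int_eigenvector_mem {F V : Type*} [Field F] [AddCommGroup V]
    [Module F V] [FiniteDimensional F V] {T : Module.End F V}
    (htop : ⨆ j : ℤ, T.eigenspace (j : F) = ⊤) {p q : Submodule F V}
    (hp : ∀ v ∈ p, T v ∈ p) (hq : ∀ (j : ℤ), ∀ v ∈ p, T v = (j : F) • v → v ∈ q) : p ≤ q := by
  have htop' : ⨆ μ : F, T.eigenspace μ = ⊤ :=
    top_le_iff.mp (htop ▸ iSup_le fun j ↦ le_iSup (fun μ : F ↦ T.eigenspace μ) (j : F))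
  rw [Submodule.eq_iSup_inf_genEigenspace (k := 1) hp htop']
  refine iSup_le fun μ v hv ↦ ?_
  obtain ⟨hvp, hvμ⟩ := Submodule.mem_inf.mp hv
  by_cases hμ : ∃ j : ℤ, (j : F) = μ
  · obtain ⟨j, rfl⟩ := hμ
    exact hq j v hvp (Module.End.mem_eigenspace_iff.mp hvμ)
  · have hle : ⨆ j : ℤ, T.eigenspace (j : F) ≤ ⨆ (ν : F) (_ : ν ≠ μ), T.eigenspace ν :=
      iSup_le fun j ↦ le_iSup₂_of_le (j : F) (fun hj ↦ hμ ⟨j, hj⟩) le_rfl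
    have hv0 := Submodule.disjoint_def.mp (T.eigenspaces_iSupIndep μ) v hvμ
      (hle (htop ▸ Submodule.mem_top))
    exact hv0 ▸ q.zero_mem


/-- for a good ℤ-grading of a semisimple Lie algebra defined by a grading
element `H`, with good element `e ∈ g 2` and an `sl₂`-triple `{e, h, f}` with `h ∈ g 0`,
`f ∈ g (-2)`, the element `z := H - h` lies in the center of the centralizer `g^s` of
the triple: `z ∈ g^s` and `z` commutes with every element of `g^s`. -/
theorem stmt3 {F L : Type*} [Field F] [CharZero F] [IsAlgClosed F]
    [LieRing L] [LieAlgebra F L] [FiniteDimensional F L]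
    [LieAlgebra.IsSemisimple F L]
    (g : ℤ → Submodule F L)
    (hdecomp : DirectSum.IsInternal g)
    (hgrade : ∀ i j : ℤ, ∀ x ∈ g i, ∀ y ∈ g j, ⁅x, y⁆ ∈ g (i + j))
    (H : L) (hH : ∀ j : ℤ, ∀ x : L, x ∈ g j ↔ ⁅H, x⁆ = (j : F) • x)
    (e h f : L) (he : e ∈ g 2)
    (hinj : ∀ j : ℤ, j ≤ -1 → ∀ x ∈ g j, ⁅e, x⁆ = 0 → x = 0)
    (hsurj : ∀ j : ℤ, -1 ≤ j → ∀ y ∈ g (j + 2), ∃ x ∈ g j, ⁅e, x⁆ = y)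
    (hh : h ∈ g 0) (hf : f ∈ g (-2))
    (t1 : ⁅h, e⁆ = (2 : F) • e) (t2 : ⁅e, f⁆ = h) (t3 : ⁅h, f⁆ = -((2 : F) • f)) :
    (⁅e, H - h⁆ = 0 ∧ ⁅h, H - h⁆ = 0 ∧ ⁅f, H - h⁆ = 0) ∧
      ∀ x : L, ⁅e, x⁆ = 0 → ⁅h, x⁆ = 0 → ⁅f, x⁆ = 0 → ⁅H - h, x⁆ = 0 := by
  have hHe : ⁅H, e⁆ = (2 : F) • e := by simpa using (hH 2 e).mp he
  have hHf : ⁅H, f⁆ = -((2 : F) • f) := by simpa using (hH (-2) f).mp hf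
  have hHh : ⁅H, h⁆ = 0 := by simpa using (hH 0 h).mp hh
  have hze : ⁅H - h, e⁆ = 0 := by rw [sub_lie, hHe, t1, sub_self]
  have hzh : ⁅H - h, h⁆ = 0 := by rw [sub_lie, hHh, lie_self, sub_self]
  have hzf : ⁅H - h, f⁆ = 0 := by rw [sub_lie, hHf, t3, sub_self]
  refine ⟨⟨?_, ?_, ?_⟩, fun x ex hx fx ↦ ?_⟩
  · rw [← lie_skew, hze, neg_zero]
  · rw [← lie_skew, hzh, neg_zero]
  · rw [← lie_skew, hzf, neg_zero]
  have hg : ∀ j : ℤ, (LieAlgebra.ad F L H).eigenspace (j : F) = g j := by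
    intro j
    ext v
    rw [Module.End.mem_eigenspace_iff, LieAlgebra.ad_apply, hH]
  have htop : ⨆ j : ℤ, (LieAlgebra.ad F L H).eigenspace (j : F) = ⊤ := by
    simp_rw [hg]
    exact hdecomp.submodule_iSup_eq_top
  have hcomm : ∀ (a : L) (c : F), ⁅H, a⁆ = c • a → ∀ v : L, ⁅a, v⁆ = 0 → ⁅a, ⁅H, v⁆⁆ = 0 := by
    intro a c ha v hv
    rw [leibniz_lie, hv, lie_zero, add_zero, ← lie_skew a H, ha, neg_lie, smul_lie, hv, smul_zero,
      neg_zero]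
  have hle : (LieAlgebra.ad F L e).ker ⊓ (LieAlgebra.ad F L h).ker ⊓ (LieAlgebra.ad F L f).ker ≤
      (LieAlgebra.ad F L H).ker := by
    refine Module.End.le_of_forall_int_eigenvector_mem htop ?_ ?_
    · rintro v ⟨⟨ev, hv⟩, fv⟩
      exact ⟨⟨hcomm e 2 hHe v ev, hcomm h 0 (by rw [hHh, zero_smul]) v hv⟩,
        hcomm f (-2) (by rw [hHf, neg_smul]) v fv⟩
    · rintro j v ⟨⟨ev, hv⟩, fv⟩ hj
      have hvj : v ∈ g j := (hH j v).mpr hj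
      rcases lt_trichotomy j 0 with hneg | rfl | hpos
      · rw [hinj j (by omega) v hvj ev]
        exact Submodule.zero_mem _
      · simpa using hj
      · obtain ⟨y, hy, hey⟩ := hsurj (j - 2) (by omega) v (by rwa [sub_add_cancel])
        obtain ⟨n, hn⟩ := exists_ad_pow_eq_zero_of_mem_neg_two
          hdecomp.submodule_iSupIndep hgrade hf hy
        rw [eq_zero_of_lie_eq_smul_of_sl2_invariant t1 t2 t3 hv fv n y 1 one_ne_zero
          (by rw [hey, one_smul]) hn]
        exact Submodule.zero_mem _
  have hHx : ⁅H, x⁆ = 0 := hle ⟨⟨ex, hx⟩, fx⟩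
  rw [sub_lie, hHx, hx, sub_self]
end

section
/- Let g = ⊕_j g_j be a Z-grading of a semisimple Lie algebra and e ∈ g_2. Then dim g^e ≥ dim g_{-1} + dim g_0, with equality if and only if e is a good element for the grading. -/
open DirectSum

/-- The elements of a graded module all of whose nonzero components have degree in `S`. -/
def supportedOn {ι F L : Type*} [DecidableEq ι] [Semiring F] [AddCommMonoid L] [Module F L]
    (g : ι → Submodule F L) [Decomposition g] (S : Set ι) : Submodule F L where
  carrier := {x | ∀ i ∉ S, decompose g x i = 0}
  add_mem' hx hy i hi := by simp [hx i hi, hy i hi]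
  zero_mem' := by simp
  smul_mem' c x hx i hi := by
    rw [decompose_smul, DirectSum.smul_apply, hx i hi, smul_zero]

lemma Submodule.finrank_map_add_finrank_inf_ker {F V W : Type*} [DivisionRing F] [AddCommGroup V]
    [Module F V] [FiniteDimensional F V] [AddCommGroup W] [Module F W]
    (U : Submodule F V) (f : V →ₗ[F] W) :
    Module.finrank F (U.map f) + Module.finrank F ↥(U ⊓ LinearMap.ker f) =
      Module.finrank F U := by
  rw [← (f.domRestrict U).finrank_range_add_finrank_ker, LinearMap.range_domRestrict,
    LinearMap.ker_domRestrict, ← Submodule.map_comap_subtype, Submodule.finrank_map_subtype_eq]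

section supportedOn

variable {ι F L : Type*} [DecidableEq ι]

section Semiring

variable [Semiring F] [AddCommMonoid L] [Module F L] {g : ι → Submodule F L} [Decomposition g]

lemma mem_supportedOn {S : Set ι} {x : L} :
    x ∈ supportedOn g S ↔ ∀ i ∉ S, decompose g x i = 0 := Iff.rfl

lemma le_supportedOn {S : Set ι} {i : ι} (hi : i ∈ S) : g i ≤ supportedOn g S := by
  intro x hx j hj
  exact Subtype.ext (decompose_of_mem_ne g hx fun h => hj (h ▸ hi))

lemma mem_of_decompose_mem {W : Submodule F L} {x : L}
    (h : ∀ i, (decompose g x i : L) ∈ W) : x ∈ W := by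
  classical
  rw [← sum_support_decompose g x]
  exact W.sum_mem fun i _ => h i

lemma supportedOn_mono {S T : Set ι} (h : S ⊆ T) : supportedOn g S ≤ supportedOn g T :=
  fun _ hx i hi => hx i fun hS => hi (h hS)

variable (g) in
lemma supportedOn_univ : supportedOn g Set.univ = ⊤ :=
  eq_top_iff.2 fun _ _ i hi => absurd (Set.mem_univ i) hi

variable (g) in
lemma supportedOn_singleton (i : ι) : supportedOn g {i} = g i := by
  refine le_antisymm (fun x hx => mem_of_decompose_mem (g := g) fun j => ?_)
    (le_supportedOn rfl)
  by_cases hj : j = i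
  · subst hj
    exact (decompose g x j).2
  · simp [hx j hj]

lemma disjoint_supportedOn {S T : Set ι} (h : Disjoint S T) :
    Disjoint (supportedOn g S) (supportedOn g T) := by
  rw [Submodule.disjoint_def]
  refine fun x hS hT => (Submodule.mem_bot F).1 (mem_of_decompose_mem (g := g) fun i => ?_)
  by_cases hi : i ∈ S
  · simp [hT i (Set.disjoint_left.1 h hi)]
  · simp [hS i hi]

lemma inf_supportedOn_union {K : Submodule F L}
    (hK : ∀ x ∈ K, ∀ i, (decompose g x i : L) ∈ K) (S T : Set ι) :
    K ⊓ supportedOn g (S ∪ T) = K ⊓ supportedOn g S ⊔ K ⊓ supportedOn g T := by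
  refine le_antisymm (fun x hx => mem_of_decompose_mem (g := g) fun i => ?_)
    (sup_le (inf_le_inf_left _ (supportedOn_mono Set.subset_union_left))
      (inf_le_inf_left _ (supportedOn_mono Set.subset_union_right)))
  by_cases hi : i ∈ S ∪ T
  · rcases hi with hi | hi
    · exact Submodule.mem_sup_left ⟨hK x hx.1 i, le_supportedOn hi (decompose g x i).2⟩
    · exact Submodule.mem_sup_right ⟨hK x hx.1 i, le_supportedOn hi (decompose g x i).2⟩
  · simp [hx.2 i hi]

end Semiring

lemma finrank_inf_supportedOn_union [DivisionRing F] [AddCommGroup L] [Module F L]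
    [FiniteDimensional F L] {g : ι → Submodule F L} [Decomposition g] {K : Submodule F L}
    (hK : ∀ x ∈ K, ∀ i, (decompose g x i : L) ∈ K) {S T : Set ι} (h : Disjoint S T) :
    Module.finrank F ↥(K ⊓ supportedOn g (S ∪ T)) =
      Module.finrank F ↥(K ⊓ supportedOn g S) + Module.finrank F ↥(K ⊓ supportedOn g T) := by
  have hd : K ⊓ supportedOn g S ⊓ (K ⊓ supportedOn g T) = ⊥ :=
    ((disjoint_supportedOn h).mono inf_le_right inf_le_right).eq_bot
  rw [inf_supportedOn_union hK, ← Submodule.finrank_sup_add_finrank_inf_eq, hd, finrank_bot,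
    add_zero]

lemma finrank_supportedOn_union [DivisionRing F] [AddCommGroup L] [Module F L]
    [FiniteDimensional F L] {g : ι → Submodule F L} [Decomposition g]
    {S T : Set ι} (h : Disjoint S T) :
    Module.finrank F (supportedOn g (S ∪ T)) =
      Module.finrank F (supportedOn g S) + Module.finrank F (supportedOn g T) := by
  have hadd := finrank_inf_supportedOn_union (g := g) (K := ⊤) (by simp) h
  rwa [top_inf_eq, top_inf_eq, top_inf_eq] at hadd

end supportedOn

section LieGrading

variable {F L : Type*} [Field F] [LieRing L] [LieAlgebra F L] {g : ℤ → Submodule F L}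

lemma lie_decompose [Decomposition g]
    (hgrade : ∀ i j : ℤ, ∀ x ∈ g i, ∀ y ∈ g j, ⁅x, y⁆ ∈ g (i + j))
    {d : ℤ} {e : L} (he : e ∈ g d) (x : L) (i : ℤ) :
    ⁅e, (decompose g x i : L)⁆ = decompose g ⁅e, x⁆ (d + i) := by
  induction x using Decomposition.inductionOn g with
  | zero => simp
  | @homogeneous j m =>
    have hm := hgrade d j e he m m.2
    by_cases h : i = j
    · subst h
      rw [decompose_of_mem_same g m.2, decompose_of_mem_same g hm]
    · rw [decompose_of_mem_ne g m.2 (Ne.symm h), decompose_of_mem_ne g hm (by omega), lie_zero]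
  | add m m' hm hm' => simp [hm, hm']

lemma killingForm_eq_zero_of_mem_of_add_ne_zero [FiniteDimensional F L]
    (hdecomp : IsInternal g)
    (hgrade : ∀ i j : ℤ, ∀ x ∈ g i, ∀ y ∈ g j, ⁅x, y⁆ ∈ g (i + j))
    {i j : ℤ} (hij : i + j ≠ 0) {x y : L} (hx : x ∈ g i) (hy : y ∈ g j) :
    killingForm F L x y = 0 := by
  rw [LieModule.traceForm_apply_apply]
  refine LinearMap.trace_eq_zero_of_mapsTo_ne hdecomp (fun k => i + (j + k)) (fun k => by omega) ?_
  intro k z hz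
  exact hgrade i _ x hx _ (hgrade j k y hy z hz)

lemma finrank_le_finrank_neg [FiniteDimensional F L] [LieAlgebra.IsKilling F L]
    (hdecomp : IsInternal g)
    (hgrade : ∀ i j : ℤ, ∀ x ∈ g i, ∀ y ∈ g j, ⁅x, y⁆ ∈ g (i + j)) (i : ℤ) :
    Module.finrank F (g i) ≤ Module.finrank F (g (-i)) := by
  let := hdecomp.chooseDecomposition
  let f : g i →ₗ[F] Module.Dual F (g (-i)) := (killingForm F L).domRestrict₁₂ (g i) (g (-i))
  have hf : Function.Injective f := by
    rw [← LinearMap.ker_eq_bot, LinearMap.ker_eq_bot']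
    intro x hx
    have hker : (x : L) ∈ LinearMap.ker (killingForm F L) := by
      refine LinearMap.ext fun y => ?_
      change y ∈ LinearMap.ker (killingForm F L (x : L))
      refine mem_of_decompose_mem (g := g) fun j => ?_
      by_cases hj : i + j = 0
      · obtain rfl : j = -i := by omega
        exact LinearMap.congr_fun hx (decompose g y (-i))
      · exact killingForm_eq_zero_of_mem_of_add_ne_zero hdecomp hgrade hj x.2
          (decompose g y j).2
    rw [LieAlgebra.IsKilling.ker_killingForm_eq_bot] at hker
    exact Subtype.ext hker
  simpa using LinearMap.finrank_le_finrank_of_injective hf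

end LieGrading

/-- for a ℤ-graded semisimple Lie algebra and `e ∈ g 2`,
`dim g^e ≥ dim (g (-1)) + dim (g 0)`, with equality iff `e` is a good element
(i.e. `ad e : g j → g (j+2)` is injective for `j ≤ -1` and surjective for `j ≥ -1`). -/
theorem stmt8 {F L : Type*} [Field F] [CharZero F] [IsAlgClosed F]
    [LieRing L] [LieAlgebra F L] [FiniteDimensional F L]
    [LieAlgebra.IsSemisimple F L]
    (g : ℤ → Submodule F L)
    (hdecomp : DirectSum.IsInternal g)
    (hgrade : ∀ i j : ℤ, ∀ x ∈ g i, ∀ y ∈ g j, ⁅x, y⁆ ∈ g (i + j))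
    (e : L) (he : e ∈ g 2) :
    Module.finrank F (g (-1)) + Module.finrank F (g 0) ≤
      Module.finrank F (LinearMap.ker (LieAlgebra.ad F L e)) ∧
    (Module.finrank F (LinearMap.ker (LieAlgebra.ad F L e)) =
        Module.finrank F (g (-1)) + Module.finrank F (g 0) ↔
      ((∀ j : ℤ, j ≤ -1 → ∀ x ∈ g j, ⁅e, x⁆ = 0 → x = 0) ∧
       (∀ j : ℤ, -1 ≤ j → ∀ y ∈ g (j + 2), ∃ x ∈ g j, ⁅e, x⁆ = y))) := by
  let := hdecomp.chooseDecomposition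
  have hlie := lie_decompose hgrade he
  set K : Submodule F L := LinearMap.ker (LieAlgebra.ad F L e) with hKdef
  have memK : ∀ x, x ∈ K ↔ ⁅e, x⁆ = 0 := fun x => by simp [hKdef]
  have hK : ∀ x ∈ K, ∀ i, (decompose g x i : L) ∈ K := by
    intro x hx i
    rw [memK] at hx ⊢
    simp [hlie, hx]
  set A := supportedOn g (Set.Iio (-1))
  set B := supportedOn g (Set.Ici (-1))
  set C := supportedOn g (Set.Ici 1)
  have hKdim : Module.finrank F K =
      Module.finrank F ↥(K ⊓ A) + Module.finrank F ↥(K ⊓ B) := by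
    rw [← finrank_inf_supportedOn_union hK (by simp), Set.Iio_union_Ici, supportedOn_univ,
      inf_top_eq]
  have hBdim : Module.finrank F B =
      Module.finrank F (g (-1)) + Module.finrank F (g 0) + Module.finrank F C := by
    have hset : (Set.Ici (-1) : Set ℤ) = {-1} ∪ {0} ∪ Set.Ici 1 := by
      ext i
      simp only [Set.mem_Ici, Set.mem_union, Set.mem_singleton_iff]
      omega
    change Module.finrank F (supportedOn g (Set.Ici (-1))) = _
    rw [hset, finrank_supportedOn_union (by simp), finrank_supportedOn_union (by simp),
      supportedOn_singleton, supportedOn_singleton]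
  have hrank : Module.finrank F (B.map (LieAlgebra.ad F L e)) +
      Module.finrank F ↥(K ⊓ B) = Module.finrank F B := by
    rw [inf_comm]
    exact B.finrank_map_add_finrank_inf_ker _
  have hmap : B.map (LieAlgebra.ad F L e) ≤ C := by
    rintro _ ⟨b, hb, rfl⟩ i hi
    have h := hlie b (i - 2)
    rw [hb (i - 2) (by simp at hi ⊢; omega), add_sub_cancel] at h
    exact Subtype.ext (by simpa using h.symm)
  have hmapdim := Submodule.finrank_mono hmap
  refine ⟨by omega, ?_⟩
  have hsurj : B.map (LieAlgebra.ad F L e) = C ↔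
      ∀ j : ℤ, -1 ≤ j → ∀ y ∈ g (j + 2), ∃ x ∈ g j, ⁅e, x⁆ = y := by
    constructor
    · intro h j hj y hy
      have hyC : y ∈ C := le_supportedOn (by simp; omega) hy
      rw [← h] at hyC
      obtain ⟨b, -, rfl⟩ := hyC
      rw [add_comm] at hy
      exact ⟨decompose g b j, (decompose g b j).2, (hlie b j).trans (decompose_of_mem_same g hy)⟩
    · refine fun h => le_antisymm hmap fun y hy => mem_of_decompose_mem (g := g) fun i => ?_
      by_cases hi : 1 ≤ i
      · obtain ⟨x, hx, hxy⟩ := h (i - 2) (by omega) (decompose g y i) (by simp)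
        exact ⟨x, le_supportedOn (by simp; omega) hx, hxy⟩
      · simp [hy i hi]
  have hinj : K ⊓ A = ⊥ ↔ ∀ j : ℤ, j < -1 → ∀ x ∈ g j, ⁅e, x⁆ = 0 → x = 0 := by
    constructor
    · intro h j hj x hx hex
      exact (Submodule.mem_bot F).1 (h ▸ ⟨(memK x).2 hex, le_supportedOn (Set.mem_Iio.2 hj) hx⟩)
    · refine fun h => (Submodule.eq_bot_iff _).2 fun x hx =>
        (Submodule.mem_bot F).1 (mem_of_decompose_mem (g := g) fun i => ?_)
      by_cases hi : i < -1
      · exact h i hi _ (decompose g x i).2 ((memK _).1 (hK x hx.1 i))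
      · simp [hx.2 i hi]
  have hmiddle : (∀ y ∈ g (-1 + 2), ∃ x ∈ g (-1), ⁅e, x⁆ = y) →
      ∀ x ∈ g (-1), ⁅e, x⁆ = 0 → x = 0 := by
    intro h x hx hex
    have hle : g 1 ≤ (g (-1)).map (LieAlgebra.ad F L e) := h
    have h1 := Submodule.finrank_mono hle
    have h2 := (g (-1)).finrank_map_add_finrank_inf_ker (LieAlgebra.ad F L e)
    rw [← hKdef] at h2
    have h3 : Module.finrank F (g (-1)) ≤ Module.finrank F (g 1) :=
      finrank_le_finrank_neg hdecomp hgrade (-1)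
    have h4 : g (-1) ⊓ K = ⊥ := Submodule.finrank_eq_zero.1 (by omega)
    exact (Submodule.mem_bot F).1 (h4 ▸ ⟨hx, (memK x).2 hex⟩)
  calc _ ↔ K ⊓ A = ⊥ ∧ B.map (LieAlgebra.ad F L e) = C := by
        rw [← Submodule.finrank_eq_zero (R := F)]
        refine ⟨fun h => ⟨by omega, Submodule.eq_of_le_of_finrank_eq hmap (by omega)⟩, ?_⟩
        rintro ⟨h1, h2⟩
        rw [h2] at hrank
        omega
    _ ↔ _ := by
        rw [hinj, hsurj]
        refine ⟨fun ⟨h1, h2⟩ => ⟨fun j hj => ?_, h2⟩, fun ⟨h1, h2⟩ => ⟨fun j hj => h1 j hj.le, h2⟩⟩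
        rcases hj.lt_or_eq with hj | rfl
        · exact h1 j hj
        · exact hmiddle (h2 (-1) le_rfl)
end

section
/- Let g = ⊕_j g_j be a good Z-grading of a semisimple Lie algebra with good element e ∈ g_2, and equip g with a nondegenerate invariant symmetric bilinear form (·,·). Then the bilinear form ⟨a,b⟩ := (e, [a,b]) on g_{-1} is nondegenerate (and skew-symmetric), and is invariant under g_0^e = g^e ∩ g_0. -/
namespace LieAlgebra

/-- The degree derivation of a `ℤ`-grading: it acts on the `i`-th piece as multiplication by `i`. -/
theorem exists_lieDerivation_eq_smul_of_isInternal {F L : Type*} [CommRing F]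
    [LieRing L] [LieAlgebra F L] (g : ℤ → Submodule F L) (hdecomp : DirectSum.IsInternal g)
    (hgrade : ∀ i j : ℤ, ∀ x ∈ g i, ∀ y ∈ g j, ⁅x, y⁆ ∈ g (i + j)) :
    ∃ D : LieDerivation F L L, ∀ i : ℤ, ∀ x ∈ g i, D x = (i : F) • x := by
  classical
  let φ := LinearEquiv.ofBijective (DirectSum.coeLinearMap g) hdecomp
  let D : L →ₗ[F] L :=
    DirectSum.toModule F ℤ L (fun i ↦ (i : F) • (g i).subtype) ∘ₗ φ.symm.toLinearMap
  have hD : ∀ i : ℤ, ∀ x ∈ g i, D x = (i : F) • x := by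
    intro i x hx
    have h : φ.symm x = DirectSum.lof F ℤ (fun i ↦ g i) i ⟨x, hx⟩ := by
      rw [LinearEquiv.symm_apply_eq]
      exact (DirectSum.coeLinearMap_lof g i ⟨x, hx⟩).symm
    simp [D, h]
  have hmem : ∀ x : L, x ∈ iSup g := fun x ↦ by
    rw [hdecomp.submodule_iSup_eq_top]; exact Submodule.mem_top
  refine ⟨⟨D, fun a b ↦ ?_⟩, hD⟩
  induction hmem a using Submodule.iSup_induction' with
  | zero => simp
  | add x y _ _ hx hy => rw [add_lie, map_add, hx, hy, map_add, lie_add, add_lie]; abel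
  | mem i x hx =>
    induction hmem b using Submodule.iSup_induction' with
    | zero => simp
    | add y z _ _ hy hz => rw [lie_add, map_add, hy, hz, map_add, lie_add, add_lie]; abel
    | mem j y hy =>
      rw [hD _ _ (hgrade i j x hx y hy), hD i x hx, hD j y hy, lie_smul, lie_smul,
        ← lie_skew y x, smul_neg, sub_neg_eq_add, Int.cast_add, add_smul, add_comm]

/-- Pieces of a `ℤ`-grading of a semisimple Lie algebra whose degrees do not sum to zero are
orthogonal for every invariant bilinear form. -/
theorem apply_eq_zero_of_add_ne_zero {F L : Type*} [Field F] [CharZero F]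
    [LieRing L] [LieAlgebra F L] [FiniteDimensional F L] [LieAlgebra.IsSemisimple F L]
    (g : ℤ → Submodule F L) (hdecomp : DirectSum.IsInternal g)
    (hgrade : ∀ i j : ℤ, ∀ x ∈ g i, ∀ y ∈ g j, ⁅x, y⁆ ∈ g (i + j))
    (B : LinearMap.BilinForm F L) (hBinv : ∀ x y z : L, B ⁅x, y⁆ z = B x ⁅y, z⁆)
    {i j : ℤ} (hij : i + j ≠ 0) {x y : L} (hx : x ∈ g i) (hy : y ∈ g j) : B x y = 0 := by
  obtain ⟨D, hD⟩ := exists_lieDerivation_eq_smul_of_isInternal g hdecomp hgrade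
  obtain ⟨h, rfl⟩ := LieDerivation.IsKilling.exists_eq_ad D
  have hx' : ⁅h, x⁆ = (i : F) • x := by simpa using hD i x hx
  have hy' : ⁅h, y⁆ = (j : F) • y := by simpa using hD j y hy
  have key := hBinv x h y
  rw [← lie_skew, hx', hy'] at key
  simp only [map_neg, map_smul, LinearMap.neg_apply, LinearMap.smul_apply, smul_eq_mul] at key
  have hmul : ((i + j : ℤ) : F) * B x y = 0 := by push_cast; linear_combination -key
  exact (mul_eq_zero.mp hmul).resolve_left (Int.cast_ne_zero.mpr hij)

end LieAlgebra


/-- for a good ℤ-grading of a semisimple Lie algebra with good element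
`e ∈ g 2` and a nondegenerate invariant symmetric bilinear form `B`, the form
`⟨a,b⟩ := B e ⁅a,b⁆` on `g (-1)` is skew-symmetric, nondegenerate, and invariant
under `g₀^e = g^e ∩ g 0`. -/
theorem stmt9 {F L : Type*} [Field F] [CharZero F] [IsAlgClosed F]
    [LieRing L] [LieAlgebra F L] [FiniteDimensional F L]
    [LieAlgebra.IsSemisimple F L]
    (g : ℤ → Submodule F L)
    (hdecomp : DirectSum.IsInternal g)
    (hgrade : ∀ i j : ℤ, ∀ x ∈ g i, ∀ y ∈ g j, ⁅x, y⁆ ∈ g (i + j))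
    (B : LinearMap.BilinForm F L) (hBnd : B.Nondegenerate)
    (hBsymm : ∀ x y : L, B x y = B y x)
    (hBinv : ∀ x y z : L, B ⁅x, y⁆ z = B x ⁅y, z⁆)
    (e : L) (he : e ∈ g 2)
    (hinj : ∀ j : ℤ, j ≤ -1 → ∀ x ∈ g j, ⁅e, x⁆ = 0 → x = 0)
    (hsurj : ∀ j : ℤ, -1 ≤ j → ∀ y ∈ g (j + 2), ∃ x ∈ g j, ⁅e, x⁆ = y) :
    (∀ a ∈ g (-1), ∀ b ∈ g (-1), B e ⁅a, b⁆ = -(B e ⁅b, a⁆)) ∧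
    (∀ a ∈ g (-1), (∀ b ∈ g (-1), B e ⁅a, b⁆ = 0) → a = 0) ∧
    (∀ z : L, ⁅e, z⁆ = 0 → z ∈ g 0 →
      ∀ a ∈ g (-1), ∀ b ∈ g (-1), B e ⁅⁅z, a⁆, b⁆ + B e ⁅a, ⁅z, b⁆⁆ = 0) := by
  refine ⟨fun a _ b _ ↦ by rw [← lie_skew, map_neg], fun a ha hab ↦ ?_,
    fun z hz _ a _ b _ ↦ ?_⟩
  · have hmem : ⁅e, a⁆ ∈ g 1 := hgrade 2 (-1) e he a ha
    refine hinj (-1) le_rfl a ha (hBnd.1 _ fun y ↦ ?_)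
    have hy : y ∈ iSup g := by rw [hdecomp.submodule_iSup_eq_top]; exact Submodule.mem_top
    induction hy using Submodule.iSup_induction' with
    | zero => simp
    | add u v _ _ hu hv => rw [map_add, hu, hv, add_zero]
    | mem j y hy =>
      by_cases hj : j = -1
      · subst hj
        rw [hBinv, hab y hy]
      · exact LieAlgebra.apply_eq_zero_of_add_ne_zero g hdecomp hgrade B hBinv
          (by omega) hmem hy
  · rw [← map_add, ← leibniz_lie, ← hBinv, hz, map_zero, LinearMap.zero_apply]
end

section
/- Let g = ⊕_{j∈Z} g_{2j} be an even Z-grading of a semisimple Lie algebra g (all odd components zero), with corresponding parabolic subalgebra p = ⊕_{j≥0} g_j whose nilradical is n = ⊕_{j>0} g_j. Then e ∈ g_2 is a Richardson element for p (i.e., the P-orbit of e is open dense in n) if and only if e is a good element for the grading. -/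
/-- An algebraically independent family stays so in some residue field. -/
theorem AlgebraicIndependent.exists_isPrime_residueField {F B ι : Type*} [Field F]
    [CommRing B] [Algebra F B] {y : ι → B} (hy : AlgebraicIndependent F y) :
    ∃ (q : Ideal B) (_ : q.IsPrime),
      AlgebraicIndependent F (fun i => algebraMap B q.ResidueField (y i)) := by
  let S : Submonoid B := (nonZeroDivisors (MvPolynomial ι F)).map (MvPolynomial.aeval (R := F) y)
  have hS : Disjoint ((⊥ : Ideal B) : Set B) (S : Set B) := by
    rw [Set.disjoint_left]
    rintro x hx ⟨q, hq, rfl⟩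
    have h0 : MvPolynomial.aeval (R := F) y q = 0 := by simpa using hx
    have := hy (h0.trans (map_zero _).symm)
    exact nonZeroDivisors.ne_zero hq this
  obtain ⟨q, hq, -, hqS⟩ := Ideal.exists_le_prime_disjoint ⊥ S hS
  refine ⟨q, hq, ?_⟩
  rw [algebraicIndependent_iff]
  intro p hp
  by_contra hp0
  have h1 : algebraMap B q.ResidueField (MvPolynomial.aeval y p) = 0 := by
    rw [← hp]
    exact MvPolynomial.comp_aeval_apply (f := y) (IsScalarTower.toAlgHom F B q.ResidueField) p
  rw [Ideal.algebraMap_residueField_eq_zero] at h1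
  exact Set.disjoint_left.1 hqS h1 ⟨p, mem_nonZeroDivisors_of_ne_zero hp0, rfl⟩

open scoped IntermediateField.algebraAdjoinAdjoin in
/-- In characteristic zero, a derivation can be prescribed on an algebraically independent
family. -/
theorem AlgebraicIndependent.exists_derivation {F K ι : Type*} [Field F] [CharZero F] [Field K]
    [Algebra F K] {y : ι → K} (hy : AlgebraicIndependent F y) (v : ι → K) :
    ∃ δ : Derivation F K K, ∀ i, δ (y i) = v i := by
  classical
  obtain ⟨T, hyT, hT⟩ := exists_isTranscendenceBasis_superset hy.coe_range
  have : CharZero K := charZero_of_injective_algebraMap (algebraMap F K).injective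
  let R := Algebra.adjoin F (Set.range ((↑) : T → K))
  let E := IntermediateField.adjoin F (Set.range ((↑) : T → K))
  have hE : Algebra.IsAlgebraic E K := hT.isAlgebraic_field
  have : Algebra.FormallySmooth E K :=
    have : Algebra.FormallyEtale E K := Algebra.FormallyEtale.of_isSeparable _ K
    inferInstance
  have : Algebra.FormallySmooth R E := .of_isLocalization (nonZeroDivisors _)
  have : Algebra.FormallySmooth R K := .comp _ E _
  obtain ⟨v', hv'⟩ : ∃ v' : K → K, ∀ i, v' (y i) = v i :=
    ⟨Function.extend y v 0, fun i => hy.injective.extend_apply v 0 i⟩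
  let ψ : R →ₐ[F] TrivSqZeroExt K K :=
    (MvPolynomial.aeval fun t : T => TrivSqZeroExt.inl (t : K) + TrivSqZeroExt.inr (v' t)).comp
      hT.1.aevalEquiv.symm.toAlgHom
  have hψ (t : T) : ψ ⟨t, Algebra.subset_adjoin ⟨t, rfl⟩⟩ =
      TrivSqZeroExt.inl (t : K) + TrivSqZeroExt.inr (v' t) := by
    have : hT.1.aevalEquiv.symm ⟨t, Algebra.subset_adjoin ⟨t, rfl⟩⟩ = MvPolynomial.X t := by
      rw [AlgEquiv.symm_apply_eq]
      ext
      simp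
    simp [ψ, this]
  have hψ' (r : R) : (ψ r).fst = (r : K) := by
    have : ((TrivSqZeroExt.fstHom F K K).comp ψ).comp hT.1.aevalEquiv.toAlgHom =
        R.val.comp hT.1.aevalEquiv.toAlgHom := by
      ext t
      simp [ψ]
    simpa using DFunLike.congr_fun this (hT.1.aevalEquiv.symm r)
  let _ : Algebra R (TrivSqZeroExt K K) := ψ.toRingHom.toAlgebra
  let fst : TrivSqZeroExt K K →ₐ[R] K :=
    { (TrivSqZeroExt.fstHom F K K).toRingHom with commutes' := hψ' }
  have hker : IsNilpotent (RingHom.ker (fst : TrivSqZeroExt K K →+* K)) :=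
    ⟨2, TrivSqZeroExt.kerIdeal_sq K K⟩
  have hsurj : Function.Surjective fst := fun x => ⟨TrivSqZeroExt.inl x, rfl⟩
  let s := Algebra.FormallySmooth.liftOfSurjective (AlgHom.id R K) fst hsurj hker
  have hs (x : K) : (s x).fst = x :=
    Algebra.FormallySmooth.liftOfSurjective_apply (AlgHom.id R K) fst hsurj hker x
  have hsF (c : F) : s (algebraMap F K c) = TrivSqZeroExt.inl (algebraMap F K c) :=
    (s.commutes (algebraMap F R c)).trans (ψ.commutes c)
  let D : K →ₗ[F] K :=
    { toFun := fun x => (s x).snd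
      map_add' := fun a b => by simp
      map_smul' := fun c a => by simp [Algebra.smul_def, hsF] }
  refine ⟨Derivation.mk' D fun a b => ?_, ?_⟩
  · simp [D, hs, mul_comm]
  · intro i
    have hi : y i ∈ T := hyT ⟨i, rfl⟩
    have h1 : s (y i) = ψ ⟨y i, Algebra.subset_adjoin ⟨⟨y i, hi⟩, rfl⟩⟩ :=
      s.commutes ⟨y i, Algebra.subset_adjoin ⟨⟨y i, hi⟩, rfl⟩⟩
    have h2 := hψ ⟨y i, hi⟩
    simp [D, h1, h2, hv']

theorem MvPolynomial.aeval_pi_apply {F X ι : Type*} [CommSemiring F] (y : ι → X → F)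
    (q : MvPolynomial ι F) (x : X) :
    MvPolynomial.aeval y q x = MvPolynomial.eval (fun i => y i x) q :=
  MvPolynomial.comp_aeval_apply (f := y) (Pi.evalAlgHom F (fun _ : X => F) x) q

open scoped TensorProduct

/-- A homomorphism from the algebra of functions on `G` to `K` induces a map from functions on `G`
with values in a finite-dimensional Lie algebra `L` to `K ⊗ L`. -/
theorem LieAlgebra.exists_functions_to_tensorProduct {F L G K : Type*} [Field F] [LieRing L]
    [LieAlgebra F L] [FiniteDimensional F L] [CommRing K] [Algebra F K] (π : (G → F) →ₐ[F] K) :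
    ∃ θ : (G → L) →ₗ[F] K ⊗[F] L, (∀ (s : G → F) (x : L), θ (fun a => s a • x) = π s ⊗ₜ x) ∧
      (∀ (s : G → F) (f : G → L), θ (fun a => s a • f a) = π s • θ f) ∧
      ∀ f h : G → L, θ (fun a => ⁅f a, h a⁆) = ⁅θ f, θ h⁆ := by
  let b := Module.finBasis F L
  let θ : (G → L) →ₗ[F] K ⊗[F] L :=
    ∑ i, (TensorProduct.mk F K L).flip (b i) ∘ₗ π.toLinearMap ∘ₗ
      (b.coord i).compLeft G
  have hθ (s : G → F) (x : L) : θ (fun a => s a • x) = π s ⊗ₜ x := by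
    conv_rhs => rw [← b.sum_repr x]
    simp only [θ, TensorProduct.tmul_sum, LinearMap.sum_apply]
    refine Finset.sum_congr rfl fun i _ => ?_
    have : (b.coord i).compLeft G (fun a => s a • x) = b.repr x i • s := by
      funext a
      simp [mul_comm]
    simp [this]
  have hrep (f : G → L) : f = ∑ i, fun a => b.repr (f a) i • b i := by
    funext a
    simp [Finset.sum_apply, b.sum_repr]
  have hθlie (f h : G → L) : θ (fun a => ⁅f a, h a⁆) = ⁅θ f, θ h⁆ := by
    have : (fun a => ⁅f a, h a⁆) = ∑ i, ∑ j, fun a =>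
        (b.repr (f a) i * b.repr (h a) j) • ⁅b i, b j⁆ := by
      funext a
      conv_lhs => rw [← b.sum_repr (f a), ← b.sum_repr (h a)]
      simp only [sum_lie_sum, Finset.sum_apply, smul_lie, lie_smul, smul_smul]
      simp only [mul_comm]
    rw [this]
    conv_rhs => rw [hrep f, hrep h]
    simp only [map_sum, hθ, sum_lie_sum, LieAlgebra.ExtendScalars.bracket_tmul, ← map_mul]
    rfl
  have hθsmul (s : G → F) (f : G → L) : θ (fun a => s a • f a) = π s • θ f := by
    have : (fun a => s a • f a) = ∑ i, fun a => (s * fun a => b.repr (f a) i) a • b i := by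
      funext a
      conv_lhs => rw [← b.sum_repr (f a), Finset.smul_sum]
      simp only [Finset.sum_apply, smul_smul, Pi.mul_apply]
    rw [this]
    conv_rhs => rw [hrep f]
    simp only [map_sum, hθ, Finset.smul_sum, map_mul, TensorProduct.smul_tmul', smul_eq_mul]
  exact ⟨θ, hθ, hθsmul, hθlie⟩

/-- If a derivation of `K` moves the image of `e` under a `K`-valued point of the automorphism group
of `L` to the image of `w`, then some derivation of `L` sends `e` to `w`. -/
theorem LieDerivation.exists_apply_eq_of_generic {F L G K κ : Type*} [Field F]
    [LieRing L] [LieAlgebra F L] [FiniteDimensional F L] [Field K] [Algebra F K] [Fintype κ]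
    (π : (G → F) →ₐ[F] K) (δ : Derivation F K K) (g : G → L ≃ₗ⁅F⁆ L) {e w : L}
    (n : κ → L) (l : κ → Module.Dual F L)
    (he : ∀ a, g a e = ∑ i, l i (g a e) • n i) (hw : ∀ a, g a w = ∑ i, l i (g a w) • n i)
    (hδ : ∀ i, δ (π fun a => l i (g a e)) = π fun a => l i (g a w)) :
    ∃ D : LieDerivation F L L, D e = w := by
  obtain ⟨θ, hθ, hθsmul, hθlie⟩ := LieAlgebra.exists_functions_to_tensorProduct (L := L) π
  let b := Module.finBasis F L
  let Φ : L →ₗ[F] K ⊗[F] L := θ ∘ₗ LinearMap.pi fun a => (g a : L →ₗ[F] L)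
  let Ψ : L →ₗ[F] K ⊗[F] L := θ ∘ₗ LinearMap.pi fun a => ((g a).symm : L →ₗ[F] L)
  have hΦ (x y : L) : Φ ⁅x, y⁆ = ⁅Φ x, Φ y⁆ := by
    refine .trans ?_ (hθlie (fun a => g a x) fun a => g a y)
    exact congrArg θ (funext fun a => (g a).map_lie x y)
  have hΨ (x y : L) : Ψ ⁅x, y⁆ = ⁅Ψ x, Ψ y⁆ := by
    refine .trans ?_ (hθlie (fun a => (g a).symm x) fun a => (g a).symm y)
    exact congrArg θ (funext fun a => (g a).symm.map_lie x y)
  let Ψ' : K ⊗[F] L →ₗ[K] K ⊗[F] L := Ψ.liftBaseChange K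
  have hΨ' (u v : K ⊗[F] L) : Ψ' ⁅u, v⁆ = ⁅Ψ' u, Ψ' v⁆ := by
    induction u with
    | zero => simp
    | add u₁ u₂ h₁ h₂ => simp [h₁, h₂]
    | tmul s x =>
      induction v with
      | zero => simp
      | add u₁ u₂ h₁ h₂ => simp [h₁, h₂]
      | tmul t y =>
        simp [Ψ', hΨ, mul_smul, LieAlgebra.ExtendScalars.bracket_tmul, smul_comm s t]
  have hΨΦ (x : L) : Ψ' (Φ x) = (1 : K) ⊗ₜ[F] x := by
    have key (f : G → L) : Ψ' (θ f) = θ fun a => (g a).symm (f a) := by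
      have : (fun a => (g a).symm (f a)) = ∑ i, fun a => b.repr (f a) i • (g a).symm (b i) := by
        funext a
        conv_lhs => rw [← b.sum_repr (f a), map_sum]
        simp [-Module.Basis.sum_repr, Finset.sum_apply]
      rw [this]
      conv_lhs =>
        rw [show f = ∑ i, fun a => b.repr (f a) i • b i by
          funext a; simp [Finset.sum_apply, b.sum_repr]]
      simp only [map_sum, hθ]
      refine Finset.sum_congr rfl fun i _ => ?_
      simp only [Ψ', LinearMap.liftBaseChange_tmul]
      exact (hθsmul _ _).symm
    refine (key _).trans ?_
    simpa using hθ 1 x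
  let Δ := Lie.Derivation.ofDerivation L δ
  obtain ⟨ev, hev⟩ : ∃ ev : K →ₗ[F] F, ev 1 = 1 := by
    obtain ⟨ev, hev⟩ := LinearMap.exists_leftInverse_of_injective (Algebra.linearMap F K)
      (LinearMap.ker_eq_bot.2 (algebraMap F K).injective)
    exact ⟨ev, by simpa using DFunLike.congr_fun hev 1⟩
  let ρ : K ⊗[F] L →ₗ[F] L := TensorProduct.lid F L ∘ₗ ev.rTensor L
  have hρ (x : L) (z : K ⊗[F] L) : ρ ⁅(1 : K) ⊗ₜ[F] x, z⁆ = ⁅x, ρ z⁆ := by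
    induction z with
    | zero => simp
    | add u₁ u₂ h₁ h₂ => simp [h₁, h₂]
    | tmul t y => simp [ρ]
  let D : L →ₗ[F] L := ρ ∘ₗ Ψ'.restrictScalars F ∘ₗ Δ.toLinearMap ∘ₗ Φ
  refine ⟨⟨D, fun x y => ?_⟩, ?_⟩
  · have : Ψ' (Δ (Φ ⁅x, y⁆)) =
        ⁅(1 : K) ⊗ₜ[F] x, Ψ' (Δ (Φ y))⁆ - ⁅(1 : K) ⊗ₜ[F] y, Ψ' (Δ (Φ x))⁆ := by
      rw [hΦ, Δ.apply_lie_eq_sub, map_sub, hΨ', hΨ', hΨΦ, hΨΦ]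
    change ρ (Ψ' (Δ (Φ ⁅x, y⁆))) = ⁅x, ρ (Ψ' (Δ (Φ y)))⁆ - ⁅y, ρ (Ψ' (Δ (Φ x)))⁆
    rw [this, map_sub, hρ, hρ]
  · have hexp (x : L) (hx : ∀ a, g a x = ∑ i, l i (g a x) • n i) :
        Φ x = ∑ i, π (fun a => l i (g a x)) ⊗ₜ n i := by
      simp only [← hθ, ← map_sum]
      refine congrArg θ (funext fun a => ?_)
      simpa [Finset.sum_apply] using hx a
    have : Δ (Φ e) = Φ w := by
      rw [hexp e he, hexp w hw, map_sum]
      refine Finset.sum_congr rfl fun i _ => ?_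
      rw [← hδ i]
      rfl
    change ρ (Ψ' (Δ (Φ e))) = w
    rw [this, hΨΦ]
    simp [ρ, hev]

/-- If the orbit of `e` under a family of automorphisms is Zariski dense in a subspace `N`, then
every tangent vector of `N` is the value at `e` of a derivation. -/
theorem LieDerivation.exists_apply_eq_of_dense_orbit {F L G : Type*} [Field F] [CharZero F]
    [LieRing L] [LieAlgebra F L] [FiniteDimensional F L] (g : G → L ≃ₗ⁅F⁆ L)
    (N : Submodule F L) (hgN : ∀ a, ∀ x ∈ N, g a x ∈ N) {e : L} (he : e ∈ N)
    (hdense : ∀ P : L → F,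
      P ∈ Algebra.adjoin F (Set.range fun φ : Module.Dual F L => (φ : L → F)) →
      (∀ a, P (g a e) = 0) → ∀ y ∈ N, P y = 0)
    {w : L} (hw : w ∈ N) : ∃ D : LieDerivation F L L, D e = w := by
  classical
  let n := Module.finBasis F N
  obtain ⟨pr, hpr⟩ := LinearMap.exists_leftInverse_of_injective N.subtype (by simp)
  let l (i) : Module.Dual F L := n.coord i ∘ₗ pr
  have hl (x : L) (hx : x ∈ N) : x = ∑ i, l i x • (n i : L) := by
    have h1 : pr x = ⟨x, hx⟩ := DFunLike.congr_fun hpr ⟨x, hx⟩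
    have h2 := congrArg N.subtype (n.sum_repr ⟨x, hx⟩)
    simp only [l, LinearMap.comp_apply, h1]
    rw [map_sum] at h2
    exact h2.symm
  have hy : AlgebraicIndependent F (fun i => fun a : G => l i (g a e)) := by
    rw [algebraicIndependent_iff]
    intro q hq
    refine MvPolynomial.funext fun z => ?_
    have hz := hdense (fun x => MvPolynomial.eval (fun i => l i x) q) ?_ ?_
      (∑ i, z i • (n i : L)) (N.sum_mem fun i _ => N.smul_mem _ (n i).2)
    · have h3 (j) : l j (∑ i, z i • (n i : L)) = z j := by
        have h1 (i) : pr (n i) = n i := DFunLike.congr_fun hpr (n i)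
        simp [l, h1, Finsupp.single_apply]
      simpa [h3] using hz
    · have : (fun x => MvPolynomial.eval (fun i => l i x) q) =
          MvPolynomial.aeval (fun i => (l i : L → F)) q := by
        funext x
        rw [MvPolynomial.aeval_pi_apply]
      rw [this]
      have h4 := AlgHom.mem_range_self (MvPolynomial.aeval (R := F) fun i => (l i : L → F)) q
      rw [← Algebra.adjoin_range_eq_range_aeval] at h4
      refine Algebra.adjoin_mono ?_ h4
      rintro _ ⟨i, rfl⟩
      exact ⟨l i, rfl⟩
    · intro a
      rw [← MvPolynomial.aeval_pi_apply (fun i => fun a : G => l i (g a e)), hq]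
      rfl
  obtain ⟨q, hq, hqy⟩ := hy.exists_isPrime_residueField
  let π : (G → F) →ₐ[F] q.ResidueField := IsScalarTower.toAlgHom F (G → F) q.ResidueField
  obtain ⟨δ, hδ⟩ := hqy.exists_derivation fun i => π fun a => l i (g a w)
  exact exists_apply_eq_of_generic π δ g (fun i => (n i : L)) l (fun a => hl _ (hgN a e he))
    (fun a => hl _ (hgN a w hw)) hδ

/-- A bilinear map on sums of graded pieces takes values in any submodule containing its values on
the pieces. -/
theorem LinearMap.apply_mem_of_mem_biSup {R M N Q ι : Type*} [CommSemiring R] [AddCommMonoid M]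
    [AddCommMonoid N] [AddCommMonoid Q] [Module R M] [Module R N] [Module R Q]
    (f : M →ₗ[R] N →ₗ[R] Q) {g : ι → Submodule R M} {h : ι → Submodule R N} {A B : Set ι}
    {S : Submodule R Q} (hS : ∀ i ∈ A, ∀ j ∈ B, ∀ x ∈ g i, ∀ y ∈ h j, f x y ∈ S)
    {x : M} (hx : x ∈ ⨆ i ∈ A, g i) {y : N} (hy : y ∈ ⨆ j ∈ B, h j) : f x y ∈ S := by
  have : Submodule.map₂ f (⨆ i ∈ A, g i) (⨆ j ∈ B, h j) ≤ S := by
    simp only [Submodule.map₂_iSup_left, Submodule.map₂_iSup_right, iSup_le_iff,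
      Submodule.map₂_le]
    exact fun j hj i hi => hS i hi j hj
  exact this (Submodule.apply_mem_map₂ f hx hy)

theorem LieAlgebra.lie_mem_biSup {F L : Type*} [Field F] [LieRing L] [LieAlgebra F L]
    {g : ℤ → Submodule F L}
    (hgrade : ∀ i j : ℤ, ∀ x ∈ g i, ∀ y ∈ g j, ⁅x, y⁆ ∈ g (i + j))
    {A B C : Set ℤ} (hC : ∀ i ∈ A, ∀ j ∈ B, g (i + j) ≠ ⊥ → i + j ∈ C)
    {x y : L} (hx : x ∈ ⨆ j ∈ A, g j) (hy : y ∈ ⨆ j ∈ B, g j) : ⁅x, y⁆ ∈ ⨆ j ∈ C, g j := by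
  refine LinearMap.apply_mem_of_mem_biSup (LieModule.toEnd F L L : L →ₗ[F] L →ₗ[F] L)
    (fun i hi j hj x hx y hy => ?_) hx hy
  have h := hgrade i j x hx y hy
  rcases eq_or_ne (g (i + j)) ⊥ with h0 | h0
  · rw [h0, Submodule.mem_bot] at h
    exact (congrArg (· ∈ _) h).mpr (zero_mem _)
  · exact Submodule.mem_iSup_of_mem (i + j) (Submodule.mem_iSup_of_mem (hC i hi j hj h0) h)

/-- The graded pieces `g i` and `g j` are orthogonal for the Killing form unless `i + j = 0`. -/
theorem LieAlgebra.killingForm_eq_zero_of_mem_biSup {F L : Type*} [Field F] [LieRing L]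
    [LieAlgebra F L] [FiniteDimensional F L] {g : ℤ → Submodule F L}
    (hgrade : ∀ i j : ℤ, ∀ x ∈ g i, ∀ y ∈ g j, ⁅x, y⁆ ∈ g (i + j))
    (hdecomp : DirectSum.IsInternal g) {A B : Set ℤ}
    (hAB : ∀ i ∈ A, ∀ j ∈ B, i + j ≠ 0) {x y : L} (hx : x ∈ ⨆ j ∈ A, g j)
    (hy : y ∈ ⨆ j ∈ B, g j) : killingForm F L x y = 0 := by
  refine (Submodule.mem_bot F).1 <|
    LinearMap.apply_mem_of_mem_biSup (killingForm F L) (fun i hi j hj x hx y hy => ?_) hx hy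
  rw [Submodule.mem_bot, killingForm_apply_apply]
  refine LinearMap.trace_eq_zero_of_mapsTo_ne hdecomp (fun k => i + (j + k))
    (fun k => by have := hAB i hi j hj; omega) fun k z hz => ?_
  exact hgrade i _ x hx _ (hgrade j k y hy z hz)

/-- If every positive element is the value at `e` of a derivation, then the centralizer of `e` is
contained in the nonnegative part. -/
theorem LieAlgebra.mem_nonneg_of_lie_eq_zero {F L : Type*} [Field F] [CharZero F] [LieRing L]
    [LieAlgebra F L] [FiniteDimensional F L] [LieAlgebra.IsSemisimple F L] {g : ℤ → Submodule F L}
    (hgrade : ∀ i j : ℤ, ∀ x ∈ g i, ∀ y ∈ g j, ⁅x, y⁆ ∈ g (i + j))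
    (hdecomp : DirectSum.IsInternal g) {e : L}
    (hD : ∀ w ∈ ⨆ j ∈ Set.Ioi (0 : ℤ), g j, ∃ D : LieDerivation F L L, D e = w)
    {z : L} (hz : ⁅e, z⁆ = 0) : z ∈ ⨆ j ∈ Set.Ici (0 : ℤ), g j := by
  have htop : (⨆ j ∈ Set.Iio (0 : ℤ), g j) ⊔ (⨆ j ∈ Set.Ici (0 : ℤ), g j) = ⊤ := by
    rw [← iSup_union, Set.Iio_union_Ici, ← hdecomp.submodule_iSup_eq_top]
    simp
  have htop' : (⨆ j ∈ Set.Iic (0 : ℤ), g j) ⊔ (⨆ j ∈ Set.Ioi (0 : ℤ), g j) = ⊤ := by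
    rw [← iSup_union, Set.Iic_union_Ioi, ← hdecomp.submodule_iSup_eq_top]
    simp
  obtain ⟨b, hb, a, ha, rfl⟩ := Submodule.mem_sup.1 (htop ▸ Submodule.mem_top : z ∈ _)
  suffices b = 0 by simpa [this] using ha
  refine (LieAlgebra.IsKilling.killingForm_nondegenerate F L).1 b fun u => ?_
  obtain ⟨c, hc, w, hw, rfl⟩ := Submodule.mem_sup.1 (htop' ▸ Submodule.mem_top : u ∈ _)
  have h1 : killingForm F L b c = 0 :=
    killingForm_eq_zero_of_mem_biSup hgrade hdecomp (fun i hi j hj => by simp at hi hj; omega) hb hc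
  have h2 : killingForm F L a w = 0 :=
    killingForm_eq_zero_of_mem_biSup hgrade hdecomp (fun i hi j hj => by simp at hi hj; omega) ha hw
  have h3 : killingForm F L (b + a) w = 0 := by
    obtain ⟨D, rfl⟩ := hD w hw
    obtain ⟨x, rfl⟩ := LieDerivation.IsKilling.exists_eq_ad D
    rw [LieDerivation.ad_apply_apply, ← lie_skew, map_neg,
      ← LieModule.traceForm_apply_lie_apply, ← lie_skew, hz]
    simp
  rw [map_add, LinearMap.add_apply, h2, add_zero] at h3
  rw [map_add, h1, h3, add_zero]

/-- If `e` is good, then every positive element is of the form `⁅x, e⁆` with `x` nonnegative. -/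
theorem LieAlgebra.exists_lie_eq_of_good {F L : Type*} [Field F] [CharZero F] [LieRing L]
    [LieAlgebra F L] [FiniteDimensional F L] [LieAlgebra.IsSemisimple F L] {g : ℤ → Submodule F L}
    (hgrade : ∀ i j : ℤ, ∀ x ∈ g i, ∀ y ∈ g j, ⁅x, y⁆ ∈ g (i + j))
    (hdecomp : DirectSum.IsInternal g) {e : L}
    (heven : ∀ j : ℤ, Odd j → g j = ⊥) (he : e ∈ g 2)
    (hgood : ∀ x : L, ⁅e, x⁆ = 0 → x ∈ ⨆ j ∈ Set.Ici (0 : ℤ), g j)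
    {w : L} (hw : w ∈ ⨆ j ∈ Set.Ioi (0 : ℤ), g j) :
    ∃ x ∈ ⨆ j ∈ Set.Ici (0 : ℤ), g j, ⁅x, e⁆ = w := by
  have htop : (⨆ j ∈ Set.Iio (0 : ℤ), g j) ⊔ (⨆ j ∈ Set.Ici (0 : ℤ), g j) = ⊤ := by
    rw [← iSup_union, Set.Iio_union_Ici, ← hdecomp.submodule_iSup_eq_top]
    simp
  have hrange : w ∈ LinearMap.range (LieModule.toEnd F L L e) := by
    rw [← LinearMap.BilinForm.orthogonal_orthogonal
      (LieAlgebra.IsKilling.killingForm_nondegenerate F L)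
      (LieModule.traceForm_isSymm F L L).isRefl (LinearMap.range _)]
    rw [LinearMap.BilinForm.mem_orthogonal_iff]
    intro m hm
    rw [LinearMap.BilinForm.mem_orthogonal_iff] at hm
    refine killingForm_eq_zero_of_mem_biSup hgrade hdecomp
      (fun i hi j hj => by simp at hi hj; omega) (hgood m ?_) hw
    refine (LieAlgebra.IsKilling.killingForm_nondegenerate F L).2 _ fun u => ?_
    have := hm _ ⟨u, rfl⟩
    rw [LieModule.toEnd_apply_apply, ← lie_skew, map_neg,
      LinearMap.neg_apply, LieModule.traceForm_apply_lie_apply] at this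
    simpa using this
  obtain ⟨x, rfl⟩ := hrange
  rw [LieModule.toEnd_apply_apply] at hw ⊢
  obtain ⟨b, hb, a, ha, rfl⟩ := Submodule.mem_sup.1 (htop ▸ Submodule.mem_top : x ∈ _)
  have he' (T : Set ℤ) (hT : 2 ∈ T) : e ∈ ⨆ j ∈ T, g j :=
    Submodule.mem_iSup_of_mem 2 (Submodule.mem_iSup_of_mem hT he)
  have h1 : ⁅e, b⁆ ∈ ⨆ j ∈ Set.Iic (0 : ℤ), g j := by
    refine lie_mem_biSup hgrade (fun i hi j hj h => ?_) (he' {2} rfl) hb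
    obtain rfl : i = 2 := hi
    have : j ≠ -1 := by
      rintro rfl
      exact h (heven _ ⟨0, rfl⟩)
    simp at hj ⊢
    omega
  have h2 : ⁅e, a⁆ ∈ ⨆ j ∈ Set.Ioi (0 : ℤ), g j :=
    lie_mem_biSup hgrade (fun i hi j hj h => by simp at hi hj ⊢; omega) (he' {2} rfl) ha
  have h3 : ⁅e, b⁆ = 0 := by
    have hd := hdecomp.submodule_iSupIndep.disjoint_biSup_biSup
      (Set.Iic_disjoint_Ioi (le_refl (0 : ℤ)))
    refine Submodule.disjoint_def.1 hd _ h1 ?_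
    rw [lie_add] at hw
    simpa using sub_mem hw h2
  refine ⟨-a, neg_mem ha, ?_⟩
  rw [lie_add, h3, zero_add, neg_lie, lie_skew]

/-- Nullstellensatz: a polynomial vanishing at every specialization of a point `a` with values in
a domain vanishes at `a`. -/
theorem MvPolynomial.aeval_eq_zero_of_forall_specialization {σ F R : Type*} [Finite σ] [Field F]
    [IsAlgClosed F] [CommRing R] [IsDomain R] [Algebra F R] (a : σ → R) (f : MvPolynomial σ F)
    (h : ∀ z : σ → F, (∀ q : MvPolynomial σ F, aeval a q = 0 → eval z q = 0) → eval z f = 0) :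
    aeval a f = 0 := by
  let I := RingHom.ker (aeval (R := F) a)
  have hI : I.IsPrime := RingHom.ker_isPrime _
  suffices f ∈ I from this
  rw [← hI.radical, ← vanishingIdeal_zeroLocus_eq_radical (K := F), mem_vanishingIdeal_iff]
  intro z hz
  rw [aeval_eq_eval]
  refine h z fun q hq => ?_
  rw [← aeval_eq_eval]
  exact hz q hq

theorem Submodule.mem_of_forall_dual_eq_zero {F L : Type*} [Field F] [AddCommGroup L] [Module F L]
    {N : Submodule F L} {x : L}
    (h : ∀ l : Module.Dual F L, (∀ y ∈ N, l y = 0) → l x = 0) : x ∈ N := by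
  by_contra hx
  obtain ⟨l, hl, hlN⟩ := N.exists_dual_map_eq_bot_of_notMem hx inferInstance
  refine hl (h l fun y hy => ?_)
  rw [← Submodule.mem_bot F, ← hlN]
  exact Submodule.mem_map_of_mem hy

theorem MvPolynomial.aeval_det_mul_aeval {F S ι : Type*} [CommRing F] [CommRing S] [Algebra F S]
    [Fintype ι] [DecidableEq ι] (c : ι → F) (p : MvPolynomial ι F) (z : ι × ι → S) :
    aeval z ((Matrix.of fun i j => X (i, j)).det *
      aeval (fun i => ∑ j, C (c j) * (X (i, j) : MvPolynomial (ι × ι) F)) p) =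
    (Matrix.of fun i j => z (i, j)).det *
      aeval (fun i => ∑ j, algebraMap F S (c j) * z (i, j)) p := by
  have h : ((aeval z).comp (aeval fun i => ∑ j, C (c j) * (X (i, j) : MvPolynomial (ι × ι) F))) =
      aeval fun i => ∑ j, algebraMap F S (c j) * z (i, j) := by
    ext i
    simp
  rw [map_mul, AlgHom.map_det, ← h, AlgHom.comp_apply]
  congr 2
  ext i j
  simp

open MvPolynomial in
/-- Let `A` be the matrix of an automorphism of `L` with coefficients in a domain, preserving
subspaces `N`. A polynomial vanishing on the orbit of `e` under the automorphisms preserving these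
subspaces vanishes at `A e`. -/
theorem LieAlgebra.aeval_eq_zero_of_forall_lieEquiv {F L R ι : Type*} [Field F] [IsAlgClosed F]
    [LieRing L] [LieAlgebra F L] [CommRing R] [IsDomain R] [Algebra F R] [Fintype ι]
    [DecidableEq ι] (b : Module.Basis ι F L) (A : Matrix ι ι R) (hdet : A.det ≠ 0)
    (hlie : ∀ j k l, ∑ m, algebraMap F R (b.repr ⁅b j, b k⁆ m) * A l m =
      ∑ i, ∑ i', algebraMap F R (b.repr ⁅b i, b i'⁆ l) * (A i j * A i' k))
    (𝒩 : Set (Submodule F L))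
    (hN : ∀ N ∈ 𝒩, ∀ l : Module.Dual F L, (∀ x ∈ N, l x = 0) → ∀ x ∈ N,
      ∑ i, ∑ j, algebraMap F R (l (b i) * b.repr x j) * A i j = 0)
    (e : L) (p : MvPolynomial ι F)
    (hp : ∀ φ : L ≃ₗ⁅F⁆ L, (∀ N ∈ 𝒩, N.map (φ : L →ₗ⁅F⁆ L).toLinearMap = N) →
      MvPolynomial.eval (b.repr (φ e)) p = 0) :
    MvPolynomial.aeval (fun i => ∑ j, algebraMap F R (b.repr e j) * A i j) p = 0 := by
  have : Module.Finite F L := .of_basis b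
  have hf := MvPolynomial.aeval_det_mul_aeval (S := R) (b.repr e) p fun ij => A ij.1 ij.2
  rw [MvPolynomial.aeval_eq_zero_of_forall_specialization] at hf
  · exact (mul_eq_zero.1 hf.symm).resolve_left hdet
  intro z hz
  let g : L →ₗ[F] L := Matrix.toLin b b (Matrix.of fun i j => z (i, j))
  have hg (j : ι) : g (b j) = ∑ i, z (i, j) • b i := by simp [g, Matrix.toLin_self]
  have hgx (x : L) (i : ι) : b.repr (g x) i = ∑ j, b.repr x j * z (i, j) := by
    simp [g, Matrix.repr_toLin, Matrix.mulVec, dotProduct, mul_comm]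
  have hglie (x y : L) : g ⁅x, y⁆ = ⁅g x, g y⁆ := by
    suffices (LieModule.toEnd F L L : L →ₗ[F] L →ₗ[F] L).compr₂ g =
        (LieModule.toEnd F L L : L →ₗ[F] L →ₗ[F] L).compl₁₂ g g from
      LinearMap.congr_fun₂ this x y
    refine LinearMap.ext_basis b b fun j k => ?_
    change g ⁅b j, b k⁆ = ⁅g (b j), g (b k)⁆
    refine b.ext_elem fun l => ?_
    have := hz (∑ m, C (b.repr ⁅b j, b k⁆ m) * X (l, m) -
      ∑ i, ∑ i', C (b.repr ⁅b i, b i'⁆ l) * (X (i, j) * X (i', k))) (by simp [hlie])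
    rw [map_sub, sub_eq_zero] at this
    rw [hgx, hg, hg, sum_lie_sum]
    simpa [mul_comm, mul_left_comm, mul_assoc] using this
  have hgN (N) (h : N ∈ 𝒩) (x) (hx : x ∈ N) : g x ∈ N := by
    refine Submodule.mem_of_forall_dual_eq_zero fun l hl => ?_
    have := hz (∑ i, ∑ j, C (l (b i) * b.repr x j) * X (i, j)) (by simpa using hN N h l hl x hx)
    rw [← b.sum_repr (g x), map_sum]
    simpa [hgx, Finset.mul_sum, mul_comm, mul_left_comm, mul_assoc] using this
  by_cases hz0 : (Matrix.of fun i j => z (i, j)).det = 0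
  · rw [← MvPolynomial.aeval_eq_eval, MvPolynomial.aeval_det_mul_aeval, hz0, zero_mul]
  have hbij : Function.Bijective g := by
    have : IsUnit (LinearMap.det g) := by
      simpa [g, LinearMap.det_toLin] using hz0
    exact (Module.End.isUnit_iff g).1 ((LinearMap.isUnit_iff_isUnit_det g).2 this)
  let φ : L ≃ₗ⁅F⁆ L := LieEquiv.ofBijective { g with map_lie' := fun {x y} => hglie x y } hbij
  have hφ := hp φ ?_
  · rw [← MvPolynomial.aeval_eq_eval, MvPolynomial.aeval_det_mul_aeval]
    refine mul_eq_zero_of_right _ ?_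
    rw [MvPolynomial.aeval_eq_eval]
    refine Eq.trans (congrArg (fun v => eval v p) (funext fun i => ?_)) hφ
    exact (hgx e i).symm
  · intro N h
    refine Submodule.eq_of_le_of_finrank_eq ?_ ?_
    · rintro _ ⟨x, hx, rfl⟩
      exact hgN N h x hx
    · exact LinearEquiv.finrank_map_eq (LinearEquiv.ofBijective g hbij) N

open Finset in
theorem Finset.Nat.sum_antidiagonal_assoc {M : Type*} [AddCommMonoid M] (f : ℕ → ℕ → ℕ → M)
    (n : ℕ) : ∑ p ∈ antidiagonal n, ∑ q ∈ antidiagonal p.2, f p.1 q.1 q.2 =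
      ∑ p ∈ antidiagonal n, ∑ q ∈ antidiagonal p.1, f q.1 q.2 p.2 := by
  simp only [sum_sigma']
  refine sum_nbij' (fun x => ⟨(x.1.1 + x.2.1, x.2.2), (x.1.1, x.2.1)⟩)
    (fun x => ⟨(x.2.1, x.2.2 + x.1.2), (x.2.2, x.1.2)⟩) ?_ ?_ ?_ ?_ ?_ <;>
  · rintro ⟨⟨i, j⟩, ⟨k, l⟩⟩
    simp only [mem_sigma, HasAntidiagonal.mem_antidiagonal]
    rintro ⟨rfl, rfl⟩
    simp [add_assoc]

open Finset in
theorem Finset.Nat.sum_antidiagonal_left_comm {M : Type*} [AddCommMonoid M] (f : ℕ → ℕ → ℕ → M)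
    (n : ℕ) : ∑ p ∈ antidiagonal n, ∑ q ∈ antidiagonal p.2, f p.1 q.1 q.2 =
      ∑ p ∈ antidiagonal n, ∑ q ∈ antidiagonal p.2, f q.1 p.1 q.2 := by
  rw [Finset.Nat.sum_antidiagonal_assoc, Finset.Nat.sum_antidiagonal_assoc fun i j => f j i]
  exact sum_congr rfl fun p _ =>
    (Finset.Nat.sum_antidiagonal_swap (f := fun q => f q.1 q.2 p.2)).symm

open Finset in
/-- The formal differential equation `E' = a E`, `E(0) = 1` has a solution. -/
theorem exists_formal_solution {F A : Type*} [Field F] [CharZero F] [Ring A] [Algebra F A]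
    (a : ℕ → A) : ∃ E : ℕ → A, E 0 = 1 ∧
      ∀ k : ℕ, (k + 1 : F) • E (k + 1) = ∑ ij ∈ antidiagonal k, a ij.1 * E ij.2 := by
  let E : ℕ → A := fun n => Nat.strongRec (motive := fun _ => A)
    (fun n ih => match n, ih with
      | 0, _ => 1
      | k + 1, ih => (k + 1 : F)⁻¹ • ∑ j : Fin (k + 1), a (k - j) * ih j j.2) n
  have hE (k : ℕ) : E (k + 1) = (k + 1 : F)⁻¹ • ∑ j : Fin (k + 1), a (k - j) * E j := by
    simp only [E]
    rw [Nat.strongRec]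
  refine ⟨E, ?_, fun k => ?_⟩
  · simp only [E]
    rw [Nat.strongRec]
  · rw [hE, smul_inv_smul₀ (Nat.cast_add_one_ne_zero k), ← Finset.Nat.sum_antidiagonal_swap]
    exact ((Finset.Nat.sum_antidiagonal_eq_sum_range_succ (fun i j => a j * E i) k).trans
      (Finset.sum_range fun j => a (k - j) * E j)).symm

open Finset in
/-- The formal flow of a time-dependent inner derivation acts by automorphisms. -/
theorem LieAlgebra.formal_solution_lie {F L : Type*} [Field F] [CharZero F] [LieRing L]
    [LieAlgebra F L] (x : ℕ → L) (E : ℕ → Module.End F L) (h0 : E 0 = 1)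
    (hE : ∀ k : ℕ, (k + 1 : F) • E (k + 1) =
      ∑ ij ∈ antidiagonal k, LieModule.toEnd F L L (x ij.1) * E ij.2) (k : ℕ) (u v : L) :
    E k ⁅u, v⁆ = ∑ ij ∈ antidiagonal k, ⁅E ij.1 u, E ij.2 v⁆ := by
  have hE' (k : ℕ) (u : L) : (k + 1 : F) • E (k + 1) u =
      ∑ ij ∈ antidiagonal k, ⁅x ij.1, E ij.2 u⁆ := by
    simpa using LinearMap.congr_fun (hE k) u
  induction k using Nat.strong_induction_on with
  | _ k ih =>
  rcases k with _ | k
  · simp [h0]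
  have hk : (k + 1 : F) ≠ 0 := Nat.cast_add_one_ne_zero k
  refine smul_right_injective L hk ?_
  change (k + 1 : F) • E (k + 1) ⁅u, v⁆ = (k + 1 : F) • _
  have h1 : (k + 1 : F) • E (k + 1) ⁅u, v⁆ =
      ∑ p ∈ antidiagonal k, ∑ q ∈ antidiagonal p.2, (⁅⁅x p.1, E q.1 u⁆, E q.2 v⁆ +
        ⁅E q.1 u, ⁅x p.1, E q.2 v⁆⁆) := by
    rw [hE']
    refine sum_congr rfl fun p hp => ?_
    rw [ih p.2 (Nat.lt_succ_of_le (by have := HasAntidiagonal.mem_antidiagonal.1 hp; omega)),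
      lie_sum]
    exact sum_congr rfl fun q _ => leibniz_lie _ _ _
  have h2 : ∑ p ∈ antidiagonal k, ∑ q ∈ antidiagonal p.2, ⁅⁅x p.1, E q.1 u⁆, E q.2 v⁆ =
      ∑ p ∈ antidiagonal k, (p.1 + 1 : F) • ⁅E (p.1 + 1) u, E p.2 v⁆ := by
    rw [Finset.Nat.sum_antidiagonal_assoc fun i j l => ⁅⁅x i, E j u⁆, E l v⁆]
    simp only [← smul_lie, hE', sum_lie]
  have h3 : ∑ p ∈ antidiagonal k, ∑ q ∈ antidiagonal p.2, ⁅E q.1 u, ⁅x p.1, E q.2 v⁆⁆ =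
      ∑ p ∈ antidiagonal k, (p.2 + 1 : F) • ⁅E p.1 u, E (p.2 + 1) v⁆ := by
    rw [Finset.Nat.sum_antidiagonal_left_comm fun i j l => ⁅E j u, ⁅x i, E l v⁆⁆]
    simp only [← lie_smul, hE', lie_sum]
  have h4 : ∑ p ∈ antidiagonal (k + 1), (p.1 : F) • ⁅E p.1 u, E p.2 v⁆ =
      ∑ p ∈ antidiagonal k, (p.1 + 1 : F) • ⁅E (p.1 + 1) u, E p.2 v⁆ := by
    simp [Finset.Nat.sum_antidiagonal_succ]
  have h5 : ∑ p ∈ antidiagonal (k + 1), (p.2 : F) • ⁅E p.1 u, E p.2 v⁆ =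
      ∑ p ∈ antidiagonal k, (p.2 + 1 : F) • ⁅E p.1 u, E (p.2 + 1) v⁆ := by
    simp [Finset.Nat.sum_antidiagonal_succ']
  simp only [h1, sum_add_distrib, h2, h3, ← h4, ← h5]
  rw [← sum_add_distrib, smul_sum]
  refine sum_congr rfl fun p hp => ?_
  rw [← add_smul, ← Nat.cast_add, HasAntidiagonal.mem_antidiagonal.1 hp, Nat.cast_succ]

/-- Every element of the algebra generated by the dual of `L` is a polynomial in the coordinates. -/
theorem MvPolynomial.exists_eval_repr_eq {F L ι : Type*} [Field F] [AddCommGroup L] [Module F L]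
    [Fintype ι] (b : Module.Basis ι F L) {P : L → F}
    (hP : P ∈ Algebra.adjoin F (Set.range fun φ : Module.Dual F L => (φ : L → F))) :
    ∃ p : MvPolynomial ι F, ∀ x, P x = MvPolynomial.eval (b.repr x) p := by
  induction hP using Algebra.adjoin_induction with
  | mem P hP =>
    obtain ⟨φ, rfl⟩ := hP
    refine ⟨∑ i, C (φ (b i)) * X i, fun x => ?_⟩
    conv_lhs => rw [← b.sum_repr x]
    simp [-Module.Basis.sum_repr, mul_comm]
  | algebraMap r => exact ⟨C r, fun x => by simp⟩
  | add P Q _ _ hP hQ =>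
    obtain ⟨p, hp⟩ := hP
    obtain ⟨q, hq⟩ := hQ
    exact ⟨p + q, fun x => by simp [hp, hq]⟩
  | mul P Q _ _ hP hQ =>
    obtain ⟨p, hp⟩ := hP
    obtain ⟨q, hq⟩ := hQ
    exact ⟨p * q, fun x => by simp [hp, hq]⟩

theorem MvPolynomial.eval_add_eq_zero_of_powerSeries {F ι : Type*} [CommRing F] (c d : ι → F)
    (p : MvPolynomial ι F)
    (h : aeval (fun i => PowerSeries.C (c i) + PowerSeries.X * PowerSeries.C (d i)) p = 0) :
    eval (c + d) p = 0 := by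
  have h1 : aeval (fun i => Polynomial.C (c i) + Polynomial.X * Polynomial.C (d i)) p = 0 := by
    refine Polynomial.coe_injective F ?_
    rw [Polynomial.coe_zero, ← h]
    refine (comp_aeval_apply (f := fun i => Polynomial.C (c i) + Polynomial.X * Polynomial.C (d i))
      (Polynomial.coeToPowerSeries.algHom F) p).trans ?_
    simp [Polynomial.coeToPowerSeries.algHom_apply, -Polynomial.X_mul_C]
  have h2 := congrArg (Polynomial.aeval (1 : F)) h1
  rw [comp_aeval_apply, map_zero] at h2
  simpa [aeval_eq_eval, ← Pi.add_def] using h2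

/-- If `[p, e] = n`, then the orbit of `e` under the automorphisms preserving `p` and `n` is
Zariski dense in `n`. -/
theorem LieAlgebra.eq_zero_of_forall_lieEquiv {F L : Type*} [Field F] [CharZero F] [IsAlgClosed F]
    [LieRing L] [LieAlgebra F L] [FiniteDimensional F L] {p n : Submodule F L}
    (hpp : ∀ x ∈ p, ∀ y ∈ p, ⁅x, y⁆ ∈ p) (hpn : ∀ x ∈ p, ∀ y ∈ n, ⁅x, y⁆ ∈ n)
    {e : L} (he : e ∈ n) (hs : ∀ w ∈ n, ∃ x ∈ p, ⁅x, e⁆ = w) {P : L → F}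
    (hP : P ∈ Algebra.adjoin F (Set.range fun φ : Module.Dual F L => (φ : L → F)))
    (h : ∀ φ : L ≃ₗ⁅F⁆ L, p.map (φ : L →ₗ⁅F⁆ L).toLinearMap = p →
      n.map (φ : L →ₗ⁅F⁆ L).toLinearMap = n → P (φ e) = 0)
    {y : L} (hy : y ∈ n) : P y = 0 := by
  classical
  choose! s hsp hse using hs
  let w := y - e
  have hw : w ∈ n := sub_mem hy he
  let x : ℕ → L := fun k => Nat.rec (s w) (fun _ z => s (-⁅z, w⁆)) k
  have hxp (k : ℕ) : x k ∈ p := by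
    induction k with
    | zero => exact hsp _ hw
    | succ k ih => exact hsp _ (neg_mem (hpn _ ih _ hw))
  have hx0 : ⁅x 0, e⁆ = w := hse _ hw
  have hxs (k : ℕ) : ⁅x (k + 1), e⁆ = -⁅x k, w⁆ := hse _ (neg_mem (hpn _ (hxp k) _ hw))
  obtain ⟨E, hE0, hE⟩ := exists_formal_solution (F := F) fun k => LieModule.toEnd F L L (x k)
  have hE' (k : ℕ) (u : L) : (k + 1 : F) • E (k + 1) u =
      ∑ j ∈ Finset.range (k + 1), ⁅x (k - j), E j u⁆ := by
    have := LinearMap.congr_fun (hE k) u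
    rw [← Finset.Nat.sum_antidiagonal_swap] at this
    simpa [Finset.Nat.sum_antidiagonal_eq_sum_range_succ_mk] using this
  have hk (k : ℕ) : (k + 1 : F) ≠ 0 := Nat.cast_add_one_ne_zero k
  have hEmem (N : Submodule F L) (hN : ∀ x ∈ p, ∀ y ∈ N, ⁅x, y⁆ ∈ N) (k : ℕ) (u : L) (hu : u ∈ N) :
      E k u ∈ N := by
    induction k using Nat.strong_induction_on with
    | _ k ih =>
    rcases k with _ | k
    · simpa [hE0] using hu
    · rw [← N.smul_mem_iff (hk k), hE']
      exact N.sum_mem fun j hj => hN _ (hxp _) _ (ih j (Finset.mem_range.1 hj))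
  have hE1 : E 1 e = w := by simpa [hE0, hx0] using hE' 0 e
  have hE2 (k : ℕ) : E (k + 2) e = 0 := by
    induction k using Nat.strong_induction_on with
    | _ k ih =>
    refine smul_right_injective L (hk (k + 1)) ?_
    simp only [smul_zero]
    rw [hE', Finset.sum_range_succ', Finset.sum_range_succ', Finset.sum_eq_zero]
    · simp only [hE0, hE1, Nat.sub_zero, zero_add, Nat.add_sub_cancel, hxs, Module.End.one_apply]
      exact add_neg_cancel _
    · intro j hj
      rw [ih j (Finset.mem_range.1 hj), lie_zero]
  let b := Module.finBasis F L
  obtain ⟨q, hq⟩ := MvPolynomial.exists_eval_repr_eq b hP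
  let A : Matrix _ _ (PowerSeries F) :=
    Matrix.of fun i j => PowerSeries.mk fun m => b.repr (E m (b j)) i
  have hA (u : L) (i) : ∑ j, algebraMap F (PowerSeries F) (b.repr u j) * A i j =
      PowerSeries.mk fun m => b.repr (E m u) i := by
    ext m
    conv_rhs => rw [← b.sum_repr u]
    simp [A, -Module.Basis.sum_repr]
  have key := LieAlgebra.aeval_eq_zero_of_forall_lieEquiv b A ?_ ?_ {p, n} ?_ e q ?_
  · have : (fun i => ∑ j, algebraMap F (PowerSeries F) (b.repr e j) * A i j) = fun i =>
        PowerSeries.C (b.repr e i) + PowerSeries.X * PowerSeries.C (b.repr w i) := by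
      funext i
      rw [hA]
      ext m
      rcases m with _ | _ | m
      · simp [hE0]
      · simp [hE1]
      · simp [hE2, PowerSeries.coeff_X]
    rw [this] at key
    have := MvPolynomial.eval_add_eq_zero_of_powerSeries _ _ _ key
    rw [hq, ← this, ← Finsupp.coe_add, ← map_add, add_sub_cancel]
  · have : A.map (PowerSeries.constantCoeff (R := F)) = 1 := by
      ext i j
      simp [A, hE0, Matrix.one_apply, Finsupp.single_apply, eq_comm]
    intro h0
    have h1 := RingHom.map_det (PowerSeries.constantCoeff (R := F)) A
    rw [h0, RingHom.mapMatrix_apply, this] at h1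
    simp at h1
  · intro j k l
    rw [hA]
    ext m
    have hb (u v : L) : b.repr ⁅u, v⁆ l =
        ∑ i, ∑ i', b.repr ⁅b i, b i'⁆ l * (b.repr u i * b.repr v i') := by
      conv_lhs => rw [← b.sum_repr u, ← b.sum_repr v]
      simp [-Module.Basis.sum_repr, sum_lie_sum, mul_comm, mul_left_comm, mul_assoc]
    rw [PowerSeries.coeff_mk, LieAlgebra.formal_solution_lie x E hE0 hE m (b j) (b k),
      map_sum, Finsupp.finsetSum_apply, Finset.sum_congr rfl fun q _ => hb _ _]
    simp only [map_sum, PowerSeries.algebraMap_apply,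
      PowerSeries.coeff_C_mul, A, Matrix.of_apply, Algebra.algebraMap_self, RingHom.id_apply]
    simp only [PowerSeries.coeff_mul, PowerSeries.coeff_mk]
    rw [Finset.sum_comm]
    refine Finset.sum_congr rfl fun i _ => ?_
    rw [Finset.sum_comm]
    exact Finset.sum_congr rfl fun i' _ => (Finset.mul_sum _ _ _).symm
  · rintro N hN l hl u hu
    have hEN (m) : l (E m u) = 0 := by
      refine hl _ (hEmem N ?_ m u hu)
      rcases hN with rfl | rfl
      exacts [hpp, hpn]
    simp only [map_mul, mul_assoc, ← Finset.mul_sum, hA]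
    ext m
    have := hEN m
    rw [← b.sum_repr (E m u)] at this
    simpa [-Module.Basis.sum_repr, PowerSeries.algebraMap_apply, mul_comm] using this
  · intro φ hφ
    rw [← hq]
    exact h φ (hφ p (by simp)) (hφ n (by simp))

/-- for an even ℤ-grading of a semisimple Lie algebra with parabolic
subalgebra `p = ⊕_{j ≥ 0} g j` and nilradical `n = ⊕_{j > 0} g j`, an element
`e ∈ g 2` is a Richardson element for `p` (its orbit under the automorphisms
preserving `p` and `n` is Zariski dense in `n`) iff `e` is good (its centralizer is
contained in `p`). -/
theorem stmt10 {F L : Type*} [Field F] [CharZero F] [IsAlgClosed F]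
    [LieRing L] [LieAlgebra F L] [FiniteDimensional F L]
    [LieAlgebra.IsSemisimple F L]
    (g : ℤ → Submodule F L)
    (hdecomp : DirectSum.IsInternal g)
    (hgrade : ∀ i j : ℤ, ∀ x ∈ g i, ∀ y ∈ g j, ⁅x, y⁆ ∈ g (i + j))
    (heven : ∀ j : ℤ, Odd j → g j = ⊥)
    (e : L) (he : e ∈ g 2) :
    (∀ P : L → F,
        P ∈ Algebra.adjoin F (Set.range fun φ : Module.Dual F L => (φ : L → F)) →
        (∀ φ : L ≃ₗ⁅F⁆ L,
          (⨆ j ∈ Set.Ici (0 : ℤ), g j).map (φ : L →ₗ⁅F⁆ L).toLinearMap =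
              ⨆ j ∈ Set.Ici (0 : ℤ), g j →
          (⨆ j ∈ Set.Ioi (0 : ℤ), g j).map (φ : L →ₗ⁅F⁆ L).toLinearMap =
              ⨆ j ∈ Set.Ioi (0 : ℤ), g j →
          P (φ e) = 0) →
        ∀ y ∈ ⨆ j ∈ Set.Ioi (0 : ℤ), g j, P y = 0) ↔
      ∀ x : L, ⁅e, x⁆ = 0 → x ∈ ⨆ j ∈ Set.Ici (0 : ℤ), g j := by
  have he' : e ∈ ⨆ j ∈ Set.Ioi (0 : ℤ), g j :=
    Submodule.mem_iSup_of_mem 2 (Submodule.mem_iSup_of_mem (by simp) he)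
  constructor
  · intro hdense x hx
    refine LieAlgebra.mem_nonneg_of_lie_eq_zero hgrade hdecomp (fun w hw => ?_) hx
    refine LieDerivation.exists_apply_eq_of_dense_orbit
      (G := {φ : L ≃ₗ⁅F⁆ L //
        (⨆ j ∈ Set.Ici (0 : ℤ), g j).map (φ : L →ₗ⁅F⁆ L).toLinearMap =
            ⨆ j ∈ Set.Ici (0 : ℤ), g j ∧
        (⨆ j ∈ Set.Ioi (0 : ℤ), g j).map (φ : L →ₗ⁅F⁆ L).toLinearMap =
            ⨆ j ∈ Set.Ioi (0 : ℤ), g j})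
      (fun φ => φ.1) _ (fun φ x hx => ?_) he' (fun P hP h => ?_) hw
    · exact φ.2.2.le (Submodule.mem_map_of_mem hx)
    · exact hdense P hP fun φ h₁ h₂ => h ⟨φ, h₁, h₂⟩
  · intro hgood P hP h y hy
    refine LieAlgebra.eq_zero_of_forall_lieEquiv (fun x hx y hy => ?_) (fun x hx y hy => ?_) he'
      (fun w hw => LieAlgebra.exists_lie_eq_of_good hgrade hdecomp heven he hgood hw) hP h hy
    · refine LieAlgebra.lie_mem_biSup hgrade (fun i hi j hj _ => ?_) hx hy
      simp only [Set.mem_Ici] at hi hj ⊢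
      lia
    · refine LieAlgebra.lie_mem_biSup hgrade (fun i hi j hj _ => ?_) hx hy
      simp only [Set.mem_Ici, Set.mem_Ioi] at hi hj ⊢
      lia
end
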